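/- arXiv:0711.2666 — 2 statements merged into one kernel-verified Lean document; each statement's English description precedes it below -/
import Mathlib

section
/- For every D ∈ ℝ, the rate function satisfies R(P,Q,D) = Λ*(P,Q,D); that is, the infimum of relative entropies over W(P,D) equals the Fenchel–Legendre transform sup_{λ ≤ 0} [λD − Λ(P,Q,λ)]. -/
open MeasureTheory Filter Set Topology Classical
open scoped ENNReal NNReal

noncomputable section

/-- `-log t` as a value in `ℝ≥0∞` (equal to `∞` when `t = 0`); intended for `t ≤ 1`. -/
def negLog (t : ℝ≥0∞) : ℝ≥0∞ :=
  if t = 0 then ∞ else ENNReal.ofReal (-Real.log t.toReal)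

/-- `log t` as a value in `ℝ≥0∞` (equal to `∞` when `t = ∞`); intended for `t ≥ 1`. -/
def posLog (t : ℝ≥0∞) : ℝ≥0∞ :=
  if t = ∞ then ∞ else ENNReal.ofReal (Real.log t.toReal)

/-- The extended-real-valued logarithm of an `ℝ≥0∞` number. -/
def eLog (t : ℝ≥0∞) : EReal :=
  if t = 0 then ⊥ else if t = ∞ then ⊤ else ((Real.log t.toReal : ℝ) : EReal)

/-- Relative entropy `H(μ‖ν)` (in nats), valued in `ℝ≥0∞`: it equals
`∫ log (dμ/dν) dμ` when `μ ≪ ν` (and `+∞` when this integral is not defined,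
which for probability measures can only mean `+∞`), and `+∞` when `¬ μ ≪ ν`. -/
def relEnt {α : Type*} [MeasurableSpace α] (μ ν : Measure α) : ℝ≥0∞ :=
  if μ ≪ ν ∧ Integrable (llr μ ν) μ then ENNReal.ofReal (∫ x, llr μ ν x ∂μ) else ∞

/-- The set `W(P,D)` of couplings: probability measures on `S × T` with first
marginal `P` and expected distortion at most `D`. -/
def distSet {S T : Type*} [MeasurableSpace S] [MeasurableSpace T]
    (ρ : S × T → ℝ) (P : Measure S) (D : ℝ) : Set (Measure (S × T)) :=
  {W | IsProbabilityMeasure W ∧ W.map Prod.fst = P ∧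
    ((∫⁻ z, ENNReal.ofReal (ρ z) ∂W : ℝ≥0∞) : EReal) ≤ ((D : ℝ) : EReal)}

/-- The rate function `R(P,Q,D) = inf_{W ∈ W(P,D)} H(W‖P×Q)` (equal to `+∞`
when `W(P,D)` is empty). -/
def Rrate {S T : Type*} [MeasurableSpace S] [MeasurableSpace T]
    (ρ : S × T → ℝ) (P : Measure S) (Q : Measure T) (D : ℝ) : ℝ≥0∞ :=
  ⨅ W ∈ distSet ρ P D, relEnt W (P.prod Q)

/-- `Λ(P,Q,λ) = E_X[log E_Y e^{λρ(X,Y)}]`, valued in `EReal`.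
For `λ ≥ 0` the integrand lies in `[0,∞]`; for `λ < 0` it lies in `[-∞,0]`. -/
def Lam {S T : Type*} [MeasurableSpace S] [MeasurableSpace T]
    (ρ : S × T → ℝ) (P : Measure S) (Q : Measure T) (l : ℝ) : EReal :=
  if 0 ≤ l then
    ((∫⁻ x, posLog (∫⁻ y, ENNReal.ofReal (Real.exp (l * ρ (x, y))) ∂Q) ∂P : ℝ≥0∞) : EReal)
  else
    -(((∫⁻ x, negLog (∫⁻ y, ENNReal.ofReal (Real.exp (l * ρ (x, y))) ∂Q) ∂P : ℝ≥0∞) : EReal))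

/-- The Fenchel–Legendre transform `Λ*(P,Q,D) = sup_{λ ≤ 0} [λD - Λ(P,Q,λ)]`. -/
def LamStar {S T : Type*} [MeasurableSpace S] [MeasurableSpace T]
    (ρ : S × T → ℝ) (P : Measure S) (Q : Measure T) (D : ℝ) : EReal :=
  ⨆ l ∈ Iic (0 : ℝ), (((l * D : ℝ) : EReal) - Lam ρ P Q l)

/-- `ρ_Q(x) := essinf_{Y ∼ Q} ρ(x,Y)`. -/
def rhoQ {S T : Type*} [MeasurableSpace T]
    (ρ : S × T → ℝ) (Q : Measure T) (x : S) : ℝ :=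
  essInf (fun y => ρ (x, y)) Q

/-- `D_min(P,Q) := inf {D : Λ*(P,Q,D) < ∞}`. -/
def DminPQ {S T : Type*} [MeasurableSpace S] [MeasurableSpace T]
    (ρ : S × T → ℝ) (P : Measure S) (Q : Measure T) : ℝ :=
  sInf {D : ℝ | LamStar ρ P Q D ≠ ⊤}

/-- `D_ave(P,Q) := E ρ(X,Y)` for independent `X ∼ P`, `Y ∼ Q`, valued in `ℝ≥0∞`. -/
def DavePQ {S T : Type*} [MeasurableSpace S] [MeasurableSpace T]
    (ρ : S × T → ℝ) (P : Measure S) (Q : Measure T) : ℝ≥0∞ :=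
  ∫⁻ z, ENNReal.ofReal (ρ z) ∂(P.prod Q)

/-- The candidate derivative `Λ'(λ)` of `Λ(P,Q,·)`. -/
def LamD {S T : Type*} [MeasurableSpace S] [MeasurableSpace T]
    (ρ : S × T → ℝ) (P : Measure S) (Q : Measure T) (l : ℝ) : ℝ :=
  ∫ x, (∫ y, ρ (x, y) * Real.exp (l * ρ (x, y)) ∂Q) /
    (∫ y, Real.exp (l * ρ (x, y)) ∂Q) ∂P

/-- The left shift on sequences. -/
def shiftSeq {α : Type*} (x : ℕ → α) (n : ℕ) : α := x (n + 1)

/-- The single-letter distortion measure `ρ_n` on `n`-strings. -/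
def rhoFin {S T : Type*} (ρ : S × T → ℝ) (n : ℕ) (x : Fin n → S) (y : Fin n → T) : ℝ :=
  (n : ℝ)⁻¹ * ∑ k, ρ (x k, y k)

/-- `L_n(x_1^n, Q^n, D) = -(1/n) log Q^n(B_n(x_1^n,D))`, valued in `ℝ≥0∞`,
for a memoryless (product) codebook distribution `Q^n`. -/
def LnIID {S T : Type*} [MeasurableSpace T]
    (ρ : S × T → ℝ) (Q : Measure T) (D : ℝ) (n : ℕ) (x : ℕ → S) : ℝ≥0∞ :=
  (n : ℝ≥0∞)⁻¹ *
    negLog ((Measure.pi fun _ : Fin n => Q) {y | rhoFin ρ n (fun k => x k) y ≤ D})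

/-- The empirical distribution `P_{x_1^n} = (1/n) ∑_{k=1}^n δ_{x_k}`. -/
def empMeas {S : Type*} [MeasurableSpace S] (n : ℕ) (x : ℕ → S) : Measure S :=
  (n : ℝ≥0∞)⁻¹ • ∑ k ∈ Finset.range n, Measure.dirac (x k)

/-- The `n`-dimensional marginal of a measure on sequences. -/
def margN {α : Type*} [MeasurableSpace α] (μ : Measure (ℕ → α)) (n : ℕ) :
    Measure (Fin n → α) :=
  μ.map fun x (k : Fin n) => x (k : ℕ)

/-- The strong mixing condition `C⁻¹ 𝒬(A) 𝒬(B) ≤ 𝒬(A ∩ B) ≤ C 𝒬(A) 𝒬(B)` for all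
`A ∈ σ(Y_1^n)`, `B ∈ σ(Y_{n+1}^∞)` and all `n`. -/
def Mixing {T : Type*} [MeasurableSpace T] (𝒬 : Measure (ℕ → T)) (C : ℝ) : Prop :=
  ∀ (n : ℕ) (A B : Set (ℕ → T)),
    MeasurableSet[MeasurableSpace.comap (fun y (k : Fin n) => y (k : ℕ)) inferInstance] A →
    MeasurableSet[MeasurableSpace.comap (fun y (k : ℕ) => y (k + n)) inferInstance] B →
    (ENNReal.ofReal C)⁻¹ * (𝒬 A * 𝒬 B) ≤ 𝒬 (A ∩ B) ∧
      𝒬 (A ∩ B) ≤ ENNReal.ofReal C * (𝒬 A * 𝒬 B)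

/-- `L_n(x_1^n, Q_n, D) = -(1/n) log Q_n(B_n(x_1^n,D))` where `Q_n` is the
`n`-dimensional marginal of the codebook process law `𝒬`. -/
def LnMem {S T : Type*} [MeasurableSpace T]
    (ρ : S × T → ℝ) (𝒬 : Measure (ℕ → T)) (D : ℝ) (n : ℕ) (x : ℕ → S) : ℝ≥0∞ :=
  (n : ℝ≥0∞)⁻¹ * negLog (margN 𝒬 n {y | rhoFin ρ n (fun k => x k) y ≤ D})

/-- The set `W_n(P_n,D)` of couplings on `S^n × T^n`. -/
def distSetN {S T : Type*} [MeasurableSpace S] [MeasurableSpace T]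
    (ρ : S × T → ℝ) (n : ℕ) (Pn : Measure (Fin n → S)) (D : ℝ) :
    Set (Measure ((Fin n → S) × (Fin n → T))) :=
  {W | IsProbabilityMeasure W ∧ W.map Prod.fst = Pn ∧
    ((∫⁻ z, ENNReal.ofReal (rhoFin ρ n z.1 z.2) ∂W : ℝ≥0∞) : EReal) ≤ ((D : ℝ) : EReal)}

/-- `R_n(P_n,Q_n,D) = (1/n) inf_{W_n ∈ W_n(P_n,D)} H(W_n‖P_n×Q_n)`. -/
def RnMem {S T : Type*} [MeasurableSpace S] [MeasurableSpace T]
    (ρ : S × T → ℝ) (n : ℕ) (Pn : Measure (Fin n → S)) (Qn : Measure (Fin n → T))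
    (D : ℝ) : ℝ≥0∞ :=
  (n : ℝ≥0∞)⁻¹ * ⨅ W ∈ distSetN ρ n Pn D, relEnt W (Pn.prod Qn)

/-- `Λ_n(P_n,Q_n,λ) = E_{X_1^n}[log E_{Y_1^n} e^{λ ρ_n(X_1^n,Y_1^n)}]`. -/
def LamN {S T : Type*} [MeasurableSpace S] [MeasurableSpace T]
    (ρ : S × T → ℝ) (n : ℕ) (Pn : Measure (Fin n → S)) (Qn : Measure (Fin n → T))
    (l : ℝ) : EReal :=
  Lam (fun z => rhoFin ρ n z.1 z.2) Pn Qn l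

/-- `Λ_n*(P_n,Q_n,D) = (1/n) sup_{λ ≤ 0} [λD - Λ_n(P_n,Q_n,λ)]`. -/
def LamStarN {S T : Type*} [MeasurableSpace S] [MeasurableSpace T]
    (ρ : S × T → ℝ) (n : ℕ) (Pn : Measure (Fin n → S)) (Qn : Measure (Fin n → T))
    (D : ℝ) : EReal :=
  (((n : ℝ)⁻¹ : ℝ) : EReal) *
    ⨆ l ∈ Iic (0 : ℝ), (((l * D : ℝ) : EReal) - LamN ρ n Pn Qn l)

/-- One-sided Fenchel–Legendre transform `D ↦ sup_{λ ≤ 0} [λD - Λ(λ)]` of a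
function `Λ : ℝ → EReal`. -/
def FLT (L : ℝ → EReal) (D : ℝ) : EReal :=
  ⨆ l ∈ Iic (0 : ℝ), (((l * D : ℝ) : EReal) - L l)

set_option linter.unusedSectionVars false
section aux
variable {S T : Type*} [MeasurableSpace S] [MeasurableSpace T]

def ZZ (ρ : S × T → ℝ) (Q : Measure T) (t : ℝ) (x : S) : ℝ :=
  ∫ y, Real.exp (-t * ρ (x, y)) ∂Q

def LL (ρ : S × T → ℝ) (Q : Measure T) (t : ℝ) (x : S) : ℝ := -Real.log (ZZ ρ Q t x)

def MM (ρ : S × T → ℝ) (Q : Measure T) (t : ℝ) (x : S) : ℝ :=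
  (∫ y, ρ (x, y) * Real.exp (-t * ρ (x, y)) ∂Q) / ZZ ρ Q t x

variable {ρ : S × T → ℝ} {P : Measure S} {Q : Measure T}
  [IsProbabilityMeasure P] [IsProbabilityMeasure Q]

lemma exp_int (hρm : Measurable ρ) (hρ0 : ∀ z, 0 ≤ ρ z) {t : ℝ} (ht : 0 ≤ t) (x : S) :
    Integrable (fun y => Real.exp (-t * ρ (x, y))) Q := by
  have hm : Measurable (fun y => Real.exp (-t * ρ (x, y))) := by fun_prop
  refine Integrable.of_bound (C := 1) hm.aestronglyMeasurable (ae_of_all _ fun y => ?_)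
  rw [Real.norm_eq_abs, abs_of_pos (Real.exp_pos _), Real.exp_le_one_iff]
  have := hρ0 (x, y)
  nlinarith [mul_nonneg ht this]

lemma ZZ_pos (hρm : Measurable ρ) (hρ0 : ∀ z, 0 ≤ ρ z) {t : ℝ} (ht : 0 ≤ t) (x : S) :
    0 < ZZ ρ Q t x := integral_exp_pos (exp_int hρm hρ0 ht x)

lemma ZZ_anti (hρm : Measurable ρ) (hρ0 : ∀ z, 0 ≤ ρ z) {s t : ℝ} (hs : 0 ≤ s) (hst : s ≤ t)
    (x : S) : ZZ ρ Q t x ≤ ZZ ρ Q s x := by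
  refine integral_mono (exp_int hρm hρ0 (hs.trans hst) x) (exp_int hρm hρ0 hs x) fun y => ?_
  have := hρ0 (x, y)
  simp only [Real.exp_le_exp]
  nlinarith

lemma ZZ_le_one (hρm : Measurable ρ) (hρ0 : ∀ z, 0 ≤ ρ z) {t : ℝ} (ht : 0 ≤ t) (x : S) :
    ZZ ρ Q t x ≤ 1 := by
  refine (ZZ_anti hρm hρ0 le_rfl ht x).trans ?_
  simp [ZZ]

lemma LL_nonneg (hρm : Measurable ρ) (hρ0 : ∀ z, 0 ≤ ρ z) {t : ℝ} (ht : 0 ≤ t) (x : S) :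
    0 ≤ LL ρ Q t x := by
  have := Real.log_nonpos (ZZ_pos (Q := Q) hρm hρ0 ht x).le (ZZ_le_one hρm hρ0 ht x)
  simp only [LL]; linarith

lemma LL_mono (hρm : Measurable ρ) (hρ0 : ∀ z, 0 ≤ ρ z) {s t : ℝ} (hs : 0 ≤ s) (hst : s ≤ t)
    (x : S) : LL ρ Q s x ≤ LL ρ Q t x := by
  have := Real.log_le_log (ZZ_pos (Q := Q) hρm hρ0 (hs.trans hst) x) (ZZ_anti hρm hρ0 hs hst x)
  simp only [LL]; linarith

lemma ZZ_meas (hρm : Measurable ρ) (t : ℝ) : Measurable (ZZ ρ Q t) := by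
  have h : Measurable (fun z : S × T => Real.exp (-t * ρ z)) := by fun_prop
  exact (h.stronglyMeasurable.integral_prod_right' (ν := Q)).measurable

lemma LL_meas (hρm : Measurable ρ) (t : ℝ) : Measurable (LL ρ Q t) :=
  (ZZ_meas hρm t).log.neg

lemma MM_meas (hρm : Measurable ρ) (t : ℝ) : Measurable (MM ρ Q t) := by
  have h : Measurable (fun z : S × T => ρ z * Real.exp (-t * ρ z)) := by fun_prop
  exact (h.stronglyMeasurable.integral_prod_right' (ν := Q)).measurable.div (ZZ_meas hρm t)

lemma exp_LL (hρm : Measurable ρ) (hρ0 : ∀ z, 0 ≤ ρ z) {t : ℝ} (ht : 0 ≤ t) (x : S) :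
    Real.exp (LL ρ Q t x) = (ZZ ρ Q t x)⁻¹ := by
  rw [LL, Real.exp_neg, Real.exp_log (ZZ_pos hρm hρ0 ht x)]

lemma bound_aux {a t r : ℝ} (ha : 0 < a) (hat : a ≤ t) (hr : 0 ≤ r) :
    r * Real.exp (-t * r) ≤ 1 / a := by
  have h1 := Real.add_one_le_exp (t * r)
  have h2 : a * r ≤ Real.exp (t * r) := by nlinarith
  rw [neg_mul, Real.exp_neg, ← div_eq_mul_inv, div_le_div_iff₀ (Real.exp_pos _) ha]
  linarith

lemma rexp_int (hρm : Measurable ρ) (hρ0 : ∀ z, 0 ≤ ρ z) {t : ℝ} (ht : 0 < t) (x : S) :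
    Integrable (fun y => ρ (x, y) * Real.exp (-t * ρ (x, y))) Q := by
  refine Integrable.of_bound (C := 1 / t) (by fun_prop) (ae_of_all _ fun y => ?_)
  rw [Real.norm_eq_abs, abs_of_nonneg (mul_nonneg (hρ0 _) (Real.exp_pos _).le)]
  exact bound_aux ht le_rfl (hρ0 _)

lemma MM_nonneg (hρm : Measurable ρ) (hρ0 : ∀ z, 0 ≤ ρ z) {t : ℝ} (ht : 0 ≤ t) (x : S) :
    0 ≤ MM ρ Q t x :=
  div_nonneg (integral_nonneg fun _ => mul_nonneg (hρ0 _) (Real.exp_pos _).le)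
    (ZZ_pos hρm hρ0 ht x).le

lemma MM_le (hρm : Measurable ρ) (hρ0 : ∀ z, 0 ≤ ρ z) {t : ℝ} (ht : 0 < t) (x : S) :
    t * MM ρ Q t x ≤ LL ρ Q t x := by
  have hZ := ZZ_pos (Q := Q) hρm hρ0 ht.le x
  have i1 := exp_int (Q := Q) hρm hρ0 ht.le x
  have i2 := rexp_int (Q := Q) hρm hρ0 ht x
  have key : ∀ y, Real.exp (-t * ρ (x, y)) - ZZ ρ Q t x ≤
      LL ρ Q t x * Real.exp (-t * ρ (x, y)) - t * (ρ (x, y) * Real.exp (-t * ρ (x, y))) := by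
    intro y
    set u := -t * ρ (x, y) + LL ρ Q t x with hu
    have h1 := Real.add_one_le_exp (-u)
    have h2 : ZZ ρ Q t x = Real.exp (-t * ρ (x, y)) * Real.exp (-u) := by
      rw [← Real.exp_add, hu]
      have : -t * ρ (x, y) + -(-t * ρ (x, y) + LL ρ Q t x) = Real.log (ZZ ρ Q t x) := by
        simp [LL]
      rw [this, Real.exp_log hZ]
    have h3 := Real.exp_pos (-t * ρ (x, y))
    nlinarith
  have := integral_mono (μ := Q) (i1.sub (integrable_const _))
    ((i1.const_mul _).sub (i2.const_mul t)) key
  simp only [Pi.sub_apply] at this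
  rw [integral_sub i1 (integrable_const _), integral_sub (i1.const_mul _) (i2.const_mul t),
    integral_const_mul, integral_const_mul] at this
  change ZZ ρ Q t x - _ ≤ LL ρ Q t x * ZZ ρ Q t x - _ at this
  simp only [integral_const, probReal_univ, one_smul, sub_self] at this
  rw [MM, ← mul_div_assoc, div_le_iff₀ hZ]
  linarith

/-- `L_t / t` is nonincreasing. -/
lemma LL_div_anti (hρm : Measurable ρ) (hρ0 : ∀ z, 0 ≤ ρ z) {s t : ℝ} (hs : 0 < s)
    (hst : s ≤ t) (x : S) : LL ρ Q t x / t ≤ LL ρ Q s x / s := by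
  have ht := hs.trans_le hst
  have h1 : (1 : ℝ) ≤ t / s := (one_le_div hs).2 hst
  have he : ∀ y, Real.exp (-s * ρ (x, y)) ^ (t / s) = Real.exp (-t * ρ (x, y)) := by
    intro y
    rw [← Real.exp_mul]; congr 1; field_simp
  have := ConvexOn.map_integral_le (μ := Q) (f := fun y => Real.exp (-s * ρ (x, y)))
    (convexOn_rpow h1) (Real.continuous_rpow_const (by positivity)).continuousOn isClosed_Ici
    (ae_of_all _ fun y => (Real.exp_pos _).le) (exp_int hρm hρ0 hs.le x)
    (by simpa only [Function.comp_def, he] using! exp_int hρm hρ0 ht.le x)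
  simp only [he] at this
  change (ZZ ρ Q s x) ^ (t / s) ≤ ZZ ρ Q t x at this
  have hZ := ZZ_pos (Q := Q) hρm hρ0 hs.le x
  have h2 := Real.log_le_log (Real.rpow_pos_of_pos hZ _) this
  rw [Real.log_rpow hZ] at h2
  rw [div_le_div_iff₀ ht hs]
  simp only [LL]
  have h3 : t / s * Real.log (ZZ ρ Q s x) * s = t * Real.log (ZZ ρ Q s x) := by field_simp
  nlinarith

lemma negLog_eq (hρm : Measurable ρ) (hρ0 : ∀ z, 0 ≤ ρ z) {l : ℝ} (hl : l < 0) (x : S) :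
    negLog (∫⁻ y, ENNReal.ofReal (Real.exp (l * ρ (x, y))) ∂Q) =
      ENNReal.ofReal (LL ρ Q (-l) x) := by
  have hZ := ZZ_pos (Q := Q) hρm hρ0 (neg_nonneg.2 hl.le) x
  have i1 := exp_int (Q := Q) hρm hρ0 (neg_nonneg.2 hl.le) x
  have : (∫⁻ y, ENNReal.ofReal (Real.exp (l * ρ (x, y))) ∂Q) = ENNReal.ofReal (ZZ ρ Q (-l) x) := by
    rw [ZZ, ofReal_integral_eq_lintegral_ofReal i1 (ae_of_all _ fun _ => (Real.exp_pos _).le)]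
    simp
  rw [this, negLog, if_neg (by simpa using hZ), ENNReal.toReal_ofReal hZ.le, LL]

lemma Lam_zero : Lam ρ P Q 0 = 0 := by
  simp [Lam, posLog]

lemma Lam_neg (hρm : Measurable ρ) (hρ0 : ∀ z, 0 ≤ ρ z) {t : ℝ} (ht : 0 < t) :
    Lam ρ P Q (-t) = -((∫⁻ x, ENNReal.ofReal (LL ρ Q t x) ∂P : ℝ≥0∞) : EReal) := by
  rw [Lam, if_neg (by linarith)]
  simp only [negLog_eq (Q := Q) hρm hρ0 (neg_lt_zero.2 ht), neg_neg]

lemma lint_ofReal_fst {W : Measure (S × T)} (hW : W.map Prod.fst = P) {k : S → ℝ≥0∞}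
    (hk : Measurable k) : ∫⁻ z, k z.1 ∂W = ∫⁻ x, k x ∂P := by
  rw [← hW, lintegral_map hk measurable_fst]

lemma gibbs_one (hρm : Measurable ρ) (hρ0 : ∀ z, 0 ≤ ρ z) {t : ℝ} (ht : 0 ≤ t) (x : S) :
    ∫⁻ y, ENNReal.ofReal (Real.exp (-t * ρ (x, y) + LL ρ Q t x)) ∂Q = 1 := by
  have i1 := exp_int (Q := Q) hρm hρ0 ht x
  have hZ := ZZ_pos (Q := Q) hρm hρ0 ht x
  simp only [Real.exp_add]
  rw [← ofReal_integral_eq_lintegral_ofReal (i1.mul_const _) (ae_of_all _ fun _ => by positivity),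
    integral_mul_const, exp_LL hρm hρ0 ht]
  change ENNReal.ofReal (ZZ ρ Q t x * _) = 1
  rw [mul_inv_cancel₀ hZ.ne', ENNReal.ofReal_one]

lemma gibbs_ineq {α : Type*} [MeasurableSpace α] {W ν : Measure α} [IsProbabilityMeasure W]
    [IsProbabilityMeasure ν] (hac : W ≪ ν) (hllri : Integrable (llr W ν) W) {h : α → ℝ}
    (hm : Measurable h) (hi : Integrable h W)
    (h1 : ∫⁻ z, ENNReal.ofReal (Real.exp (h z)) ∂ν ≤ 1) :
    ∫ z, h z ∂W ≤ ∫ z, llr W ν z ∂W := by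
  have hb : ∫⁻ z, ENNReal.ofReal (Real.exp (h z - llr W ν z)) ∂W ≤ 1 := by
    calc ∫⁻ z, ENNReal.ofReal (Real.exp (h z - llr W ν z)) ∂W
        ≤ ∫⁻ z, (ν.rnDeriv W * fun z => ENNReal.ofReal (Real.exp (h z))) z ∂W := by
          refine lintegral_mono_ae ?_
          filter_upwards [exp_neg_llr hac] with z hz
          rw [sub_eq_add_neg, Real.exp_add, hz, ENNReal.ofReal_mul (Real.exp_pos _).le,
            Pi.mul_apply, mul_comm]
          gcongr
          exact ENNReal.ofReal_toReal_le
      _ = ∫⁻ z, ENNReal.ofReal (Real.exp (h z)) ∂(W.withDensity (ν.rnDeriv W)) :=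
          (lintegral_withDensity_eq_lintegral_mul W (Measure.measurable_rnDeriv ν W)
            (by fun_prop)).symm
      _ ≤ ∫⁻ z, ENNReal.ofReal (Real.exp (h z)) ∂ν :=
          lintegral_mono' (Measure.withDensity_rnDeriv_le ν W) le_rfl
      _ ≤ 1 := h1
  have hme : Measurable fun z => Real.exp (h z - llr W ν z) :=
    (hm.sub (measurable_llr W ν)).exp
  have hie : Integrable (fun z => Real.exp (h z - llr W ν z)) W := by
    refine ⟨hme.aestronglyMeasurable, ?_⟩
    rw [hasFiniteIntegral_iff_ofReal (ae_of_all _ fun _ => (Real.exp_pos _).le)]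
    exact hb.trans_lt ENNReal.one_lt_top
  have hle : ∫ z, Real.exp (h z - llr W ν z) ∂W ≤ 1 := by
    rw [integral_eq_lintegral_of_nonneg_ae (ae_of_all _ fun _ => (Real.exp_pos _).le)
      hme.aestronglyMeasurable]
    exact ENNReal.toReal_le_of_le_ofReal zero_le_one (by simpa using hb)
  have hs : Integrable (fun z => h z - llr W ν z) W := hi.sub hllri
  have := integral_mono (μ := W) (hs.add (integrable_const 1)) hie
    (fun z => Real.add_one_le_exp (h z - llr W ν z))
  simp only [Pi.add_apply] at this
  rw [integral_add hs (integrable_const _), integral_sub hi hllri] at this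
  simp at this
  linarith

lemma easy_dir (hρm : Measurable ρ) (hρ0 : ∀ z, 0 ≤ ρ z) {t D : ℝ} (ht : 0 < t)
    {W : Measure (S × T)} (hW : W ∈ distSet ρ P D) :
    ∫⁻ x, ENNReal.ofReal (LL ρ Q t x) ∂P ≤ relEnt W (P.prod Q) + ENNReal.ofReal (t * D) := by
  obtain ⟨hp, hf, hD⟩ := hW
  have hD0 : 0 ≤ D := by
    have := (EReal.coe_ennreal_nonneg _).trans hD
    exact_mod_cast this
  have hD' : ∫⁻ z, ENNReal.ofReal (ρ z) ∂W ≤ ENNReal.ofReal D := by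
    rw [← EReal.coe_ennreal_le_coe_ennreal_iff, EReal.coe_ennreal_ofReal, max_eq_left hD0]
    exact hD
  rw [relEnt]
  split_ifs with hc
  swap
  · simp
  obtain ⟨hac, hllri⟩ := hc
  have hρi : Integrable ρ W := by
    refine ⟨hρm.aestronglyMeasurable, ?_⟩
    rw [hasFiniteIntegral_iff_ofReal (ae_of_all _ hρ0)]
    exact hD'.trans_lt ENNReal.ofReal_lt_top
  have hρle : ∫ z, ρ z ∂W ≤ D := by
    rw [integral_eq_lintegral_of_nonneg_ae (ae_of_all _ hρ0) hρm.aestronglyMeasurable]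
    exact ENNReal.toReal_le_of_le_ofReal hD0 hD'
  have hLm := LL_meas (Q := Q) hρm t
  have hL0 := fun x => LL_nonneg (Q := Q) hρm hρ0 ht.le x
  have key : ∀ N : ℕ, ∫⁻ x, ENNReal.ofReal (min (LL ρ Q t x) N) ∂P ≤
      ENNReal.ofReal (∫ z, llr W (P.prod Q) z ∂W) + ENNReal.ofReal (t * D) := by
    intro N
    have hmm : Measurable fun x => min (LL ρ Q t x) (N : ℝ) := hLm.min measurable_const
    have hmi : Integrable (fun z : S × T => min (LL ρ Q t z.1) (N : ℝ)) W := by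
      refine Integrable.of_bound (C := N) (hmm.comp measurable_fst).aestronglyMeasurable
        (ae_of_all _ fun z => ?_)
      rw [Real.norm_eq_abs, abs_of_nonneg (le_min (hL0 _) (Nat.cast_nonneg _))]
      exact min_le_right _ _
    have hi : Integrable (fun z : S × T => -t * ρ z + min (LL ρ Q t z.1) (N : ℝ)) W :=
      (hρi.const_mul _).add hmi
    have hm : Measurable (fun z : S × T => -t * ρ z + min (LL ρ Q t z.1) (N : ℝ)) :=
      (hρm.const_mul _).add (hmm.comp measurable_fst)
    have h1 : ∫⁻ z, ENNReal.ofReal (Real.exp (-t * ρ z + min (LL ρ Q t z.1) (N : ℝ)))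
        ∂(P.prod Q) ≤ 1 := by
      rw [lintegral_prod _ (by fun_prop)]
      calc _ ≤ ∫⁻ x, 1 ∂P := by
            refine lintegral_mono fun x => ?_
            rw [← gibbs_one (Q := Q) hρm hρ0 ht.le x]
            refine lintegral_mono fun y => ?_
            gcongr
            exact min_le_left _ _
        _ = 1 := by simp
    have hg := gibbs_ineq hac hllri hm hi h1
    rw [integral_add (hρi.const_mul _) hmi, integral_const_mul] at hg
    rw [← lint_ofReal_fst hf (k := fun x => ENNReal.ofReal (min (LL ρ Q t x) N)) (by fun_prop),
      ← ofReal_integral_eq_lintegral_ofReal hmi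
        (ae_of_all _ fun z => le_min (hL0 _) (Nat.cast_nonneg _)),
      ← ENNReal.ofReal_add _ (by positivity)]
    · apply ENNReal.ofReal_le_ofReal
      nlinarith
    · have := gibbs_ineq hac hllri (h := fun _ => 0) measurable_const (integrable_const _) (by simp)
      simpa using this
  refine le_of_tendsto' (lintegral_tendsto_of_tendsto_of_monotone
    (f := fun (N : ℕ) x => ENNReal.ofReal (min (LL ρ Q t x) N)) (by fun_prop) ?_ ?_) key
  · refine ae_of_all _ fun x a b hab => ?_
    simp only
    gcongr
  · refine ae_of_all _ fun x => ?_
    obtain ⟨n, hn⟩ := exists_nat_ge (LL ρ Q t x)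
    refine tendsto_const_nhds.congr' ?_
    filter_upwards [eventually_ge_atTop n] with m hm
    rw [min_eq_left (hn.trans (by exact_mod_cast hm))]

lemma constr_fst {g : S × T → ℝ} (hg : Measurable g)
    (h1 : ∀ᵐ x ∂P, ∫⁻ y, ENNReal.ofReal (g (x, y)) ∂Q = 1) :
    ((P.prod Q).withDensity fun z => ENNReal.ofReal (g z)).map Prod.fst = P := by
  ext s hs
  rw [Measure.map_apply measurable_fst hs, withDensity_apply _ (measurable_fst hs),
    ← lintegral_indicator (measurable_fst hs), lintegral_prod _ (by
      exact (Measurable.indicator (by fun_prop) (measurable_fst hs)).aemeasurable)]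
  calc _ = ∫⁻ x, s.indicator (fun _ => 1) x ∂P := by
        refine lintegral_congr_ae ?_
        filter_upwards [h1] with x hx
        by_cases hxs : x ∈ s
        · simp [indicator, hxs, hx]
        · simp [indicator, hxs]
    _ = P s := by rw [lintegral_indicator hs]; simp

lemma constr_prob {g : S × T → ℝ} (hg : Measurable g)
    (h1 : ∀ᵐ x ∂P, ∫⁻ y, ENNReal.ofReal (g (x, y)) ∂Q = 1) :
    IsProbabilityMeasure ((P.prod Q).withDensity fun z => ENNReal.ofReal (g z)) := by
  constructor
  have := congrArg (fun μ => μ univ) (constr_fst hg h1)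
  simpa [Measure.map_apply measurable_fst MeasurableSet.univ] using this

lemma relEnt_wd {g k : S × T → ℝ} (hg : Measurable g) (hg0 : ∀ z, 0 ≤ g z)
    (hk : Integrable k ((P.prod Q).withDensity fun z => ENNReal.ofReal (g z)))
    (hgk : ∀ᵐ z ∂((P.prod Q).withDensity fun z => ENNReal.ofReal (g z)), Real.log (g z) = k z) :
    relEnt ((P.prod Q).withDensity fun z => ENNReal.ofReal (g z)) (P.prod Q) =
      ENNReal.ofReal (∫ z, k z ∂((P.prod Q).withDensity fun z => ENNReal.ofReal (g z))) := by
  set W := (P.prod Q).withDensity fun z => ENNReal.ofReal (g z) with hW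
  have hac : W ≪ P.prod Q := withDensity_absolutelyContinuous _ _
  have hrn : W.rnDeriv (P.prod Q) =ᵐ[P.prod Q] fun z => ENNReal.ofReal (g z) :=
    Measure.rnDeriv_withDensity _ (by fun_prop)
  have hll : llr W (P.prod Q) =ᵐ[W] k := by
    filter_upwards [hac.ae_le hrn, hgk] with z h1 h2
    rw [llr, h1, ENNReal.toReal_ofReal (hg0 z), h2]
  rw [relEnt, if_pos ⟨hac, hk.congr hll.symm⟩, integral_congr_ae hll]

lemma mem_distSet {g : S × T → ℝ} (hg : Measurable g) {D : ℝ} (hD : 0 ≤ D)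
    (h1 : ∀ᵐ x ∂P, ∫⁻ y, ENNReal.ofReal (g (x, y)) ∂Q = 1)
    (h2 : ∫⁻ z, ENNReal.ofReal (ρ z) ∂((P.prod Q).withDensity fun z => ENNReal.ofReal (g z)) ≤
      ENNReal.ofReal D) :
    ((P.prod Q).withDensity fun z => ENNReal.ofReal (g z)) ∈ distSet ρ P D := by
  refine ⟨constr_prob hg h1, constr_fst hg h1, ?_⟩
  have := EReal.coe_ennreal_le_coe_ennreal_iff.2 h2
  rwa [EReal.coe_ennreal_ofReal, max_eq_left hD] at this

lemma MM_integrable (hρm : Measurable ρ) (hρ0 : ∀ z, 0 ≤ ρ z) {t : ℝ} (ht : 0 < t)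
    (hL : Integrable (LL ρ Q t) P) : Integrable (MM ρ Q t) P := by
  refine (hL.const_mul t⁻¹).mono' (MM_meas hρm t).aestronglyMeasurable (ae_of_all _ fun x => ?_)
  rw [Real.norm_eq_abs, abs_of_nonneg (MM_nonneg hρm hρ0 ht.le x), ← div_eq_inv_mul,
    le_div_iff₀ ht, mul_comm]
  exact MM_le hρm hρ0 ht x

lemma tilt (hρm : Measurable ρ) (hρ0 : ∀ z, 0 ≤ ρ z) {t D : ℝ} (ht : 0 < t) (hD : 0 ≤ D)
    (hL : Integrable (LL ρ Q t) P) (hm : ∫ x, MM ρ Q t x ∂P ≤ D) :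
    Rrate ρ P Q D ≤ ENNReal.ofReal (-t * ∫ x, MM ρ Q t x ∂P + ∫ x, LL ρ Q t x ∂P) := by
  have hLm := LL_meas (Q := Q) hρm t
  set g : S × T → ℝ := fun z => Real.exp (-t * ρ z + LL ρ Q t z.1) with hg
  have hgm : Measurable g :=
    ((hρm.const_mul _).add (hLm.comp measurable_fst)).exp
  have hg1 : ∀ᵐ x ∂P, ∫⁻ y, ENNReal.ofReal (g (x, y)) ∂Q = 1 :=
    ae_of_all _ fun x => gibbs_one hρm hρ0 ht.le x
  have hMi := MM_integrable hρm hρ0 ht hL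
  set W := (P.prod Q).withDensity fun z => ENNReal.ofReal (g z) with hWdef
  have hWp : IsProbabilityMeasure W := constr_prob hgm hg1
  have hWf : W.map Prod.fst = P := constr_fst hgm hg1
  have hρW : ∫⁻ z, ENNReal.ofReal (ρ z) ∂W = ENNReal.ofReal (∫ x, MM ρ Q t x ∂P) := by
    rw [hWdef, lintegral_withDensity_eq_lintegral_mul _ (by fun_prop) (by fun_prop),
      lintegral_prod _ (by fun_prop), ofReal_integral_eq_lintegral_ofReal hMi
        (ae_of_all _ fun x => MM_nonneg hρm hρ0 ht.le x)]
    refine lintegral_congr fun x => ?_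
    have i2 := rexp_int (Q := Q) hρm hρ0 ht x
    rw [MM, ← integral_div, ofReal_integral_eq_lintegral_ofReal (i2.div_const _) (ae_of_all _
      fun y => div_nonneg (mul_nonneg (hρ0 _) (Real.exp_pos _).le) (ZZ_pos hρm hρ0 ht.le x).le)]
    refine lintegral_congr fun y => ?_
    simp only [Pi.mul_apply, hg]
    rw [← ENNReal.ofReal_mul (Real.exp_pos _).le, Real.exp_add, exp_LL hρm hρ0 ht.le]
    congr 1
    ring
  have hρi : Integrable ρ W := by
    refine ⟨hρm.aestronglyMeasurable, ?_⟩
    rw [hasFiniteIntegral_iff_ofReal (ae_of_all _ hρ0), hρW]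
    exact ENNReal.ofReal_lt_top
  have hρint : ∫ z, ρ z ∂W = ∫ x, MM ρ Q t x ∂P := by
    rw [integral_eq_lintegral_of_nonneg_ae (ae_of_all _ hρ0) hρm.aestronglyMeasurable, hρW,
      ENNReal.toReal_ofReal (integral_nonneg fun x => MM_nonneg hρm hρ0 ht.le x)]
  have hLW : Integrable (fun z : S × T => LL ρ Q t z.1) W := by
    rw [← hWf] at hL
    exact hL.comp_measurable measurable_fst
  have hLint : ∫ z, LL ρ Q t z.1 ∂W = ∫ x, LL ρ Q t x ∂P := by
    rw [← hWf, integral_map measurable_fst.aemeasurable hLm.aestronglyMeasurable]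
  have hmem : W ∈ distSet ρ P D := by
    refine mem_distSet hgm hD hg1 ?_
    rw [← hWdef, hρW]
    exact ENNReal.ofReal_le_ofReal hm
  refine (iInf₂_le W hmem).trans (le_of_eq ?_)
  rw [hWdef, relEnt_wd (k := fun z => -t * ρ z + LL ρ Q t z.1) hgm (fun z => (Real.exp_pos _).le)
    ((hρi.const_mul _).add hLW) (ae_of_all _ fun z => Real.log_exp _), ← hWdef,
    integral_add (hρi.const_mul _) hLW, integral_const_mul, hρint, hLint]

lemma corner (hρm : Measurable ρ) (hρ0 : ∀ z, 0 ≤ ρ z) {c D : ℝ} (hD : 0 ≤ D) (hc : 0 ≤ c)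
    {r : S → ℝ} (hrm : Measurable r)
    (hr : ∫⁻ x, ENNReal.ofReal (r x) ∂P ≤ ENNReal.ofReal D)
    (hp : ∫⁻ x, negLog (Q {y | ρ (x, y) = r x}) ∂P ≤ ENNReal.ofReal c) :
    Rrate ρ P Q D ≤ ENNReal.ofReal c := by
  set A : Set (S × T) := {z | ρ z = r z.1} with hA
  have hAm : MeasurableSet A := measurableSet_eq_fun hρm (hrm.comp measurable_fst)
  set p : S → ℝ≥0∞ := fun x => Q {y | ρ (x, y) = r x} with hpdef
  have hpm : Measurable p := measurable_measure_prodMk_left hAm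
  have hp1 : ∀ x, p x ≤ 1 := fun x => prob_le_one
  have hnm : Measurable fun x => negLog (p x) := by
    unfold negLog
    exact Measurable.ite (hpm (measurableSet_singleton 0)) measurable_const (by fun_prop)
  have hp0 : ∀ᵐ x ∂P, p x ≠ 0 := by
    filter_upwards [ae_lt_top hnm (hp.trans_lt ENNReal.ofReal_lt_top).ne] with x hx h0
    simp [negLog, h0] at hx
  set g : S × T → ℝ := A.indicator fun z => ((p z.1).toReal)⁻¹ with hg
  have hgm : Measurable g :=
    Measurable.indicator (hpm.comp measurable_fst).ennreal_toReal.inv hAm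
  have hg0 : ∀ z, 0 ≤ g z := fun z => indicator_nonneg (fun _ _ => by positivity) z
  have hg1 : ∀ᵐ x ∂P, ∫⁻ y, ENNReal.ofReal (g (x, y)) ∂Q = 1 := by
    filter_upwards [hp0] with x hx
    have hxt : p x ≠ ∞ := ((hp1 x).trans_lt ENNReal.one_lt_top).ne
    have hB : MeasurableSet {y | ρ (x, y) = r x} :=
      measurableSet_eq_fun (by fun_prop) measurable_const
    have : ∀ y, ENNReal.ofReal (g (x, y)) =
        ({y | ρ (x, y) = r x} : Set T).indicator (fun _ => (p x)⁻¹) y := by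
      intro y
      by_cases hy : ρ (x, y) = r x
      · simp only [hg, indicator, hA, mem_ofPred_eq, hy, if_true]
        rw [ENNReal.ofReal_inv_of_pos (ENNReal.toReal_pos hx hxt), ENNReal.ofReal_toReal hxt]
      · simp [hg, indicator, hA, hy]
    simp only [this]
    rw [lintegral_indicator hB, setLIntegral_const]
    exact ENNReal.inv_mul_cancel hx hxt
  set W := (P.prod Q).withDensity fun z => ENNReal.ofReal (g z) with hWdef
  have hWp : IsProbabilityMeasure W := constr_prob hgm hg1
  have hWf : W.map Prod.fst = P := constr_fst hgm hg1
  have hWA : ∀ᵐ z ∂W, z ∈ A := by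
    rw [hWdef, ae_withDensity_iff (by fun_prop)]
    refine ae_of_all _ fun z hz => ?_
    by_contra h
    simp [hg, h] at hz
  have hmem : W ∈ distSet ρ P D := by
    refine mem_distSet hgm hD hg1 ?_
    rw [← hWdef]
    refine le_trans (le_of_eq ?_) hr
    rw [← lint_ofReal_fst hWf (k := fun x => ENNReal.ofReal (r x)) (by fun_prop)]
    refine lintegral_congr_ae ?_
    filter_upwards [hWA] with z hz
    rw [show ρ z = r z.1 from hz]
  have hlog0 : ∀ x, 0 ≤ -Real.log (p x).toReal := by
    intro x
    have : (p x).toReal ≤ 1 := ENNReal.toReal_le_of_le_ofReal zero_le_one (by simpa using hp1 x)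
    have := Real.log_nonpos ENNReal.toReal_nonneg this
    linarith
  have hkm : Measurable fun x => -Real.log (p x).toReal := hpm.ennreal_toReal.log.neg
  have hkb : ∫⁻ z, ENNReal.ofReal (-Real.log (p z.1).toReal) ∂W ≤ ENNReal.ofReal c := by
    rw [lint_ofReal_fst hWf (k := fun x => ENNReal.ofReal (-Real.log (p x).toReal)) (by fun_prop)]
    refine le_trans (lintegral_mono fun x => ?_) hp
    simp only [negLog]
    split_ifs
    · exact le_top
    · exact le_rfl
  have hkm' : Measurable fun z : S × T => -Real.log (p z.1).toReal := hkm.comp measurable_fst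
  have hki : Integrable (fun z : S × T => -Real.log (p z.1).toReal) W := by
    refine ⟨hkm'.aestronglyMeasurable, ?_⟩
    rw [hasFiniteIntegral_iff_ofReal (ae_of_all _ fun z : S × T => hlog0 z.1)]
    exact hkb.trans_lt ENNReal.ofReal_lt_top
  refine (iInf₂_le W hmem).trans ?_
  rw [hWdef, relEnt_wd (k := fun z => -Real.log (p z.1).toReal) hgm hg0 hki, ← hWdef,
    ofReal_integral_eq_lintegral_ofReal hki (ae_of_all _ fun z => hlog0 z.1)]
  · exact hkb
  · rw [← hWdef]
    filter_upwards [hWA] with z hz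
    simp [hg, hz, Real.log_inv]

def RR (ρ : S × T → ℝ) (Q : Measure T) (x : S) : ℝ :=
  ⨅ n : ℕ, LL ρ Q ((n : ℝ) + 1) x / ((n : ℝ) + 1)

lemma RR_bdd (hρm : Measurable ρ) (hρ0 : ∀ z, 0 ≤ ρ z) (x : S) :
    BddBelow (range fun n : ℕ => LL ρ Q ((n : ℝ) + 1) x / ((n : ℝ) + 1)) := by
  refine ⟨0, ?_⟩
  rintro _ ⟨n, rfl⟩
  exact div_nonneg (LL_nonneg hρm hρ0 (by positivity) x) (by positivity)

lemma RR_nonneg (hρm : Measurable ρ) (hρ0 : ∀ z, 0 ≤ ρ z) (x : S) : 0 ≤ RR ρ Q x :=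
  le_ciInf fun n => div_nonneg (LL_nonneg hρm hρ0 (by positivity) x) (by positivity)

lemma RR_le (hρm : Measurable ρ) (hρ0 : ∀ z, 0 ≤ ρ z) (x : S) (n : ℕ) :
    ((n : ℝ) + 1) * RR ρ Q x ≤ LL ρ Q ((n : ℝ) + 1) x := by
  have : RR ρ Q x ≤ LL ρ Q ((n : ℝ) + 1) x / ((n : ℝ) + 1) := ciInf_le (RR_bdd hρm hρ0 x) n
  rwa [le_div_iff₀ (by positivity), mul_comm] at this

lemma RR_tendsto (hρm : Measurable ρ) (hρ0 : ∀ z, 0 ≤ ρ z) (x : S) :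
    Tendsto (fun n : ℕ => LL ρ Q ((n : ℝ) + 1) x / ((n : ℝ) + 1)) atTop (𝓝 (RR ρ Q x)) := by
  refine tendsto_atTop_ciInf (fun a b hab => ?_) (RR_bdd hρm hρ0 x)
  have : (a : ℝ) ≤ b := by exact_mod_cast hab
  exact LL_div_anti hρm hρ0 (by positivity) (by linarith) x

lemma RR_meas (hρm : Measurable ρ) (hρ0 : ∀ z, 0 ≤ ρ z) : Measurable (RR ρ Q) :=
  measurable_of_tendsto_metrizable (fun n : ℕ => (LL_meas (Q := Q) hρm ((n : ℝ) + 1)).div_const _)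
    (tendsto_pi_nhds.2 fun x => RR_tendsto hρm hρ0 x)

lemma ZZ_le_RR (hρm : Measurable ρ) (hρ0 : ∀ z, 0 ≤ ρ z) (x : S) (n : ℕ) :
    ZZ ρ Q ((n : ℝ) + 1) x ≤ Real.exp (-(((n : ℝ) + 1) * RR ρ Q x)) := by
  rw [← Real.log_le_iff_le_exp (ZZ_pos hρm hρ0 (by positivity) x)]
  have := RR_le (Q := Q) hρm hρ0 x n
  rw [LL] at this
  linarith

lemma RR_ae (hρm : Measurable ρ) (hρ0 : ∀ z, 0 ≤ ρ z) (x : S) :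
    ∀ᵐ y ∂Q, RR ρ Q x ≤ ρ (x, y) := by
  have h : ∀ k : ℕ, ∀ᵐ y ∂Q, RR ρ Q x - 1 / ((k : ℝ) + 1) < ρ (x, y) := by
    intro k
    set ε : ℝ := 1 / ((k : ℝ) + 1) with hε
    have hε0 : 0 < ε := by positivity
    set B : Set T := {y | ρ (x, y) ≤ RR ρ Q x - ε} with hB
    have hq : ∀ n : ℕ, Q.real B ≤ Real.exp (-(((n : ℝ) + 1) * ε)) := by
      intro n
      set t : ℝ := (n : ℝ) + 1 with ht
      have ht0 : 0 < t := by positivity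
      have h1 := mul_meas_ge_le_integral_of_nonneg (μ := Q)
        (ae_of_all _ fun y => (Real.exp_pos (-t * ρ (x, y))).le) (exp_int hρm hρ0 ht0.le x)
        (Real.exp (-t * (RR ρ Q x - ε)))
      have h2 : Q.real B ≤ Q.real {y | Real.exp (-t * (RR ρ Q x - ε)) ≤
          Real.exp (-t * ρ (x, y))} := by
        refine measureReal_mono fun y hy => ?_
        have hy' : ρ (x, y) ≤ RR ρ Q x - ε := hy
        change Real.exp _ ≤ Real.exp _
        rw [Real.exp_le_exp]
        nlinarith
      have h3 := ZZ_le_RR (Q := Q) hρm hρ0 x n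
      have h4 := Real.exp_pos (-t * (RR ρ Q x - ε))
      have h5 : Real.exp (-t * (RR ρ Q x - ε)) * Q.real B ≤ Real.exp (-(t * RR ρ Q x)) :=
        (mul_le_mul_of_nonneg_left h2 h4.le).trans (h1.trans h3)
      have h6 : Real.exp (-(t * RR ρ Q x)) =
          Real.exp (-t * (RR ρ Q x - ε)) * Real.exp (-(t * ε)) := by
        rw [← Real.exp_add]; congr 1; ring
      rw [h6] at h5
      exact le_of_mul_le_mul_left h5 h4
    have hlim : Tendsto (fun n : ℕ => Real.exp (-(((n : ℝ) + 1) * ε))) atTop (𝓝 0) := by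
      refine Real.tendsto_exp_neg_atTop_nhds_zero.comp ?_
      exact (tendsto_atTop_add_const_right _ _ tendsto_natCast_atTop_atTop).atTop_mul_const hε0
    have h0 : Q.real B = 0 := le_antisymm (ge_of_tendsto' hlim hq) measureReal_nonneg
    have h0' : Q B = 0 := by
      rwa [measureReal_eq_zero_iff] at h0
    rw [ae_iff]
    simpa [hB] using h0'
  filter_upwards [ae_all_iff.2 h] with y hy
  refine le_of_forall_pos_lt_add fun δ hδ => ?_
  obtain ⟨k, hk⟩ := exists_nat_one_div_lt hδ
  have := hy k
  linarith

lemma ZZ_tendsto (hρm : Measurable ρ) (hρ0 : ∀ z, 0 ≤ ρ z) (x : S) :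
    Tendsto (fun n : ℕ => ZZ ρ Q ((n : ℝ) + 1) x * Real.exp (((n : ℝ) + 1) * RR ρ Q x)) atTop
      (𝓝 (Q.real {y | ρ (x, y) = RR ρ Q x})) := by
  have hB : MeasurableSet {y | ρ (x, y) = RR ρ Q x} :=
    measurableSet_eq_fun (by fun_prop) measurable_const
  have h1 : ∀ n : ℕ, ZZ ρ Q ((n : ℝ) + 1) x * Real.exp (((n : ℝ) + 1) * RR ρ Q x) =
      ∫ y, Real.exp (-(((n : ℝ) + 1) * (ρ (x, y) - RR ρ Q x))) ∂Q := by
    intro n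
    rw [ZZ, ← integral_mul_const]
    refine integral_congr_ae (ae_of_all _ fun y => ?_)
    simp only [← Real.exp_add]
    congr 1; ring
  have h2 : Q.real {y | ρ (x, y) = RR ρ Q x} =
      ∫ y, ({y | ρ (x, y) = RR ρ Q x} : Set T).indicator (fun _ => (1 : ℝ)) y ∂Q := by
    rw [integral_indicator hB]; simp
  simp only [h1]
  rw [h2]
  refine tendsto_integral_of_dominated_convergence (fun _ => 1) (fun n => ?_)
    (integrable_const _) (fun n => ?_) ?_
  · have : Measurable fun y => Real.exp (-(((n : ℝ) + 1) * (ρ (x, y) - RR ρ Q x))) := by fun_prop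
    exact this.aestronglyMeasurable
  · filter_upwards [RR_ae hρm hρ0 x] with y hy
    rw [Real.norm_eq_abs, abs_of_pos (Real.exp_pos _), Real.exp_le_one_iff]
    have : 0 ≤ ((n : ℝ) + 1) * (ρ (x, y) - RR ρ Q x) :=
      mul_nonneg (by positivity) (by linarith)
    linarith
  · filter_upwards [RR_ae hρm hρ0 x] with y hy
    rcases hy.eq_or_lt with h | h
    · have h' : ρ (x, y) = RR ρ Q x := h.symm
      simp [indicator, h']
    · have h' : ¬ ρ (x, y) = RR ρ Q x := h.ne'
      simp only [indicator, mem_ofPred_eq, h', if_false]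
      refine Real.tendsto_exp_neg_atTop_nhds_zero.comp ?_
      exact (tendsto_atTop_add_const_right _ _ tendsto_natCast_atTop_atTop).atTop_mul_const
        (by linarith)

lemma negLog_tendsto (hρm : Measurable ρ) (hρ0 : ∀ z, 0 ≤ ρ z) (x : S) :
    Tendsto (fun n : ℕ => ENNReal.ofReal (LL ρ Q ((n : ℝ) + 1) x - ((n : ℝ) + 1) * RR ρ Q x)) atTop
      (𝓝 (negLog (Q {y | ρ (x, y) = RR ρ Q x}))) := by
  have h := ZZ_tendsto (Q := Q) hρm hρ0 x
  have hpos : ∀ n : ℕ, 0 < ZZ ρ Q ((n : ℝ) + 1) x * Real.exp (((n : ℝ) + 1) * RR ρ Q x) :=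
    fun n => mul_pos (ZZ_pos hρm hρ0 (by positivity) x) (Real.exp_pos _)
  have he : ∀ n : ℕ, LL ρ Q ((n : ℝ) + 1) x - ((n : ℝ) + 1) * RR ρ Q x =
      -Real.log (ZZ ρ Q ((n : ℝ) + 1) x * Real.exp (((n : ℝ) + 1) * RR ρ Q x)) := by
    intro n
    rw [Real.log_mul (ZZ_pos hρm hρ0 (by positivity) x).ne' (Real.exp_pos _).ne', Real.log_exp, LL]
    ring
  simp only [he]
  rw [negLog]
  split_ifs with h0
  · rw [measureReal_def, h0, ENNReal.toReal_zero] at h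
    have h' : Tendsto (fun n : ℕ => ZZ ρ Q ((n : ℝ) + 1) x * Real.exp (((n : ℝ) + 1) * RR ρ Q x))
        atTop (𝓝[>] 0) := tendsto_nhdsWithin_iff.2 ⟨h, Eventually.of_forall hpos⟩
    exact ENNReal.tendsto_ofReal_nhds_top.2 (tendsto_neg_atBot_atTop.comp
      (Real.tendsto_log_nhdsGT_zero.comp h'))
  · have hne : Q.real {y | ρ (x, y) = RR ρ Q x} ≠ 0 := by
      rwa [ne_eq, measureReal_eq_zero_iff]
    exact ENNReal.tendsto_ofReal (h.log hne).neg

lemma MM_cont (hρm : Measurable ρ) (hρ0 : ∀ z, 0 ≤ ρ z) (x : S) {t : ℝ} (ht : 0 < t) :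
    ContinuousAt (fun s => MM ρ Q s x) t := by
  have hev : ∀ᶠ s in 𝓝 t, t / 2 < s := lt_mem_nhds (by linarith)
  refine ContinuousAt.div ?_ ?_ (ZZ_pos hρm hρ0 ht.le x).ne'
  · refine continuousAt_of_dominated (bound := fun _ => 1 / (t / 2)) ?_ ?_ (integrable_const _) ?_
    · filter_upwards [hev] with s hs
      exact (rexp_int hρm hρ0 (by linarith) x).aestronglyMeasurable
    · filter_upwards [hev] with s hs
      refine ae_of_all _ fun y => ?_
      rw [Real.norm_eq_abs, abs_of_nonneg (mul_nonneg (hρ0 _) (Real.exp_pos _).le)]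
      exact bound_aux (by linarith) hs.le (hρ0 _)
    · exact ae_of_all _ fun y => by fun_prop
  · refine continuousAt_of_dominated (bound := fun _ => 1) ?_ ?_ (integrable_const _) ?_
    · filter_upwards [hev] with s hs
      exact (exp_int hρm hρ0 (by linarith) x).aestronglyMeasurable
    · filter_upwards [hev] with s hs
      refine ae_of_all _ fun y => ?_
      rw [Real.norm_eq_abs, abs_of_pos (Real.exp_pos _), Real.exp_le_one_iff]
      have := hρ0 (x, y)
      nlinarith
    · exact ae_of_all _ fun y => by fun_prop

lemma m_cont (hρm : Measurable ρ) (hρ0 : ∀ z, 0 ≤ ρ z)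
    (hLi : ∀ t, 0 < t → Integrable (LL ρ Q t) P) {t : ℝ} (ht : 0 < t) :
    ContinuousAt (fun s => ∫ x, MM ρ Q s x ∂P) t := by
  have hev : ∀ᶠ s in 𝓝 t, t / 2 < s := lt_mem_nhds (by linarith)
  have hev2 : ∀ᶠ s in 𝓝 t, s < 2 * t := gt_mem_nhds (by linarith)
  refine continuousAt_of_dominated (bound := fun x => LL ρ Q (2 * t) x / (t / 2)) ?_ ?_
    ((hLi (2 * t) (by linarith)).div_const _) ?_
  · exact Eventually.of_forall fun s => (MM_meas hρm s).aestronglyMeasurable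
  · filter_upwards [hev, hev2] with s hs hs2
    refine ae_of_all _ fun x => ?_
    have hs0 : 0 < s := by linarith
    have h0 := MM_nonneg (Q := Q) hρm hρ0 hs0.le x
    rw [Real.norm_eq_abs, abs_of_nonneg h0, le_div_iff₀ (by linarith)]
    have h1 := MM_le (Q := Q) hρm hρ0 hs0 x
    have h2 := LL_mono (Q := Q) hρm hρ0 hs0.le hs2.le x
    nlinarith
  · exact ae_of_all _ fun x => MM_cont hρm hρ0 x ht

lemma hard_dir (hρm : Measurable ρ) (hρ0 : ∀ z, 0 ≤ ρ z) {c D : ℝ} (hc : 0 ≤ c)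
    (hLi : ∀ t, 0 < t → Integrable (LL ρ Q t) P)
    (hLb : ∀ t, 0 < t → ∫ x, LL ρ Q t x ∂P ≤ c + t * D) :
    Rrate ρ P Q D ≤ ENNReal.ofReal c := by
  have hn0 : ∀ n : ℕ, (0 : ℝ) < (n : ℝ) + 1 := fun n => by positivity
  have hRm := RR_meas (Q := Q) hρm hρ0
  have hR0 := fun x => RR_nonneg (Q := Q) hρm hρ0 x
  have hRi : Integrable (RR ρ Q) P := by
    refine (hLi 1 one_pos).mono' hRm.aestronglyMeasurable (ae_of_all _ fun x => ?_)
    rw [Real.norm_eq_abs, abs_of_nonneg (hR0 x)]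
    simpa using RR_le (Q := Q) hρm hρ0 x 0
  have hlim : Tendsto (fun n : ℕ => ∫ x, LL ρ Q ((n : ℝ) + 1) x / ((n : ℝ) + 1) ∂P) atTop
      (𝓝 (∫ x, RR ρ Q x ∂P)) := by
    refine tendsto_integral_of_dominated_convergence (LL ρ Q 1)
      (fun n => ((LL_meas hρm _).div_const _).aestronglyMeasurable) (hLi 1 one_pos) (fun n => ?_)
      (ae_of_all _ fun x => RR_tendsto hρm hρ0 x)
    refine ae_of_all _ fun x => ?_
    rw [Real.norm_eq_abs, abs_of_nonneg
      (div_nonneg (LL_nonneg hρm hρ0 (hn0 n).le x) (hn0 n).le)]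
    have := LL_div_anti (Q := Q) hρm hρ0 one_pos (show (1 : ℝ) ≤ (n : ℝ) + 1 by simp) x
    simpa using this
  have hRD : ∫ x, RR ρ Q x ∂P ≤ D := by
    have h1 : Tendsto (fun n : ℕ => c * (1 / ((n : ℝ) + 1)) + D) atTop (𝓝 (c * 0 + D)) :=
      (tendsto_one_div_add_atTop_nhds_zero_nat.const_mul c).add_const D
    rw [mul_zero, zero_add] at h1
    refine le_of_tendsto_of_tendsto' hlim h1 fun n => ?_
    rw [integral_div, div_le_iff₀ (hn0 n)]
    refine (hLb _ (hn0 n)).trans (le_of_eq ?_)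
    have := (hn0 n).ne'
    field_simp
  have hD0 : 0 ≤ D := (integral_nonneg hR0).trans hRD
  rcases hRD.eq_or_lt with hEq | hLt
  · refine corner hρm hρ0 hD0 hc hRm ?_ ?_
    · rw [← ofReal_integral_eq_lintegral_ofReal hRi (ae_of_all _ hR0), hEq]
    · calc ∫⁻ x, negLog (Q {y | ρ (x, y) = RR ρ Q x}) ∂P
          = ∫⁻ x, liminf (fun n : ℕ => ENNReal.ofReal
              (LL ρ Q ((n : ℝ) + 1) x - ((n : ℝ) + 1) * RR ρ Q x)) atTop ∂P :=
            lintegral_congr fun x => (negLog_tendsto hρm hρ0 x).liminf_eq.symm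
        _ ≤ liminf (fun n : ℕ => ∫⁻ x, ENNReal.ofReal
              (LL ρ Q ((n : ℝ) + 1) x - ((n : ℝ) + 1) * RR ρ Q x) ∂P) atTop :=
            lintegral_liminf_le fun n =>
              ((LL_meas hρm _).sub (hRm.const_mul _)).ennreal_ofReal
        _ ≤ ENNReal.ofReal c := by
            refine liminf_le_of_frequently_le' (Frequently.of_forall fun n => ?_)
            have hsi : Integrable (fun x => LL ρ Q ((n : ℝ) + 1) x - ((n : ℝ) + 1) * RR ρ Q x) P :=
              (hLi _ (hn0 n)).sub (hRi.const_mul _)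
            rw [← ofReal_integral_eq_lintegral_ofReal hsi
              (ae_of_all _ fun x => sub_nonneg.2 (RR_le hρm hρ0 x n)),
              integral_sub (hLi _ (hn0 n)) (hRi.const_mul _), integral_const_mul, hEq]
            refine ENNReal.ofReal_le_ofReal ?_
            have := hLb _ (hn0 n)
            linarith
  · obtain ⟨n, hn⟩ := (hlim.eventually (gt_mem_nhds hLt)).exists
    set b : ℝ := (n : ℝ) + 1 with hb
    have hb0 : 0 < b := hn0 n
    have hmb : ∫ x, MM ρ Q b x ∂P < D := by
      refine lt_of_le_of_lt (integral_mono (MM_integrable hρm hρ0 hb0 (hLi b hb0))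
        ((hLi b hb0).div_const _) fun x => ?_) hn
      simp only
      rw [le_div_iff₀ hb0, mul_comm]
      exact MM_le hρm hρ0 hb0 x
    by_cases hex : ∃ t, 0 < t ∧ t ≤ b ∧ D ≤ ∫ x, MM ρ Q t x ∂P
    · obtain ⟨t, ht0, htb, htD⟩ := hex
      have hcont : ContinuousOn (fun s => ∫ x, MM ρ Q s x ∂P) (Icc t b) := fun s hs =>
        (m_cont hρm hρ0 hLi (ht0.trans_le hs.1)).continuousWithinAt
      obtain ⟨s, hs, hsD⟩ := intermediate_value_Icc' htb hcont ⟨hmb.le, htD⟩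
      have hs0 : 0 < s := ht0.trans_le hs.1
      simp only at hsD
      refine (tilt hρm hρ0 hs0 hD0 (hLi s hs0) hsD.le).trans (ENNReal.ofReal_le_ofReal ?_)
      rw [hsD]
      have := hLb s hs0
      linarith
    · push Not at hex
      have hub : ∀ t, 0 < t → t ≤ b → Rrate ρ P Q D ≤ ENNReal.ofReal (c + t * D) := by
        intro t ht0 htb
        refine (tilt hρm hρ0 ht0 hD0 (hLi t ht0) (hex t ht0 htb).le).trans
          (ENNReal.ofReal_le_ofReal ?_)
        have h1 := hLb t ht0
        have h2 : 0 ≤ t * ∫ x, MM ρ Q t x ∂P :=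
          mul_nonneg ht0.le (integral_nonneg fun x => MM_nonneg hρm hρ0 ht0.le x)
        linarith
      have h1 : Tendsto (fun t : ℝ => ENNReal.ofReal (c + t * D)) (𝓝[>] 0)
          (𝓝 (ENNReal.ofReal c)) := by
        have : Continuous fun t : ℝ => ENNReal.ofReal (c + t * D) :=
          ENNReal.continuous_ofReal.comp (by fun_prop)
        have h2 := this.tendsto 0
        simp only [zero_mul, add_zero] at h2
        exact h2.mono_left nhdsWithin_le_nhds
      refine ge_of_tendsto h1 ?_
      filter_upwards [Ioc_mem_nhdsGT hb0] with t ht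
      exact hub t ht.1 ht.2

end aux

/-- for every `D ∈ ℝ`, `R(P,Q,D) = Λ*(P,Q,D)`. -/
theorem stmt0 {S T : Type*} [MeasurableSpace S] [StandardBorelSpace S]
    [MeasurableSpace T] [StandardBorelSpace T]
    (ρ : S × T → ℝ) (hρm : Measurable ρ) (hρ0 : ∀ z, 0 ≤ ρ z)
    (P : Measure S) (Q : Measure T) [IsProbabilityMeasure P] [IsProbabilityMeasure Q]
    (D : ℝ) :
    ((Rrate ρ P Q D : ℝ≥0∞) : EReal) = LamStar ρ P Q D := by
  apply le_antisymm
  · by_cases htop : LamStar ρ P Q D = ⊤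
    · rw [htop]; exact le_top
    have h0 : 0 ≤ LamStar ρ P Q D := by
      have := le_iSup₂ (f := fun (l : ℝ) (_ : l ∈ Iic (0 : ℝ)) =>
        (((l * D : ℝ) : EReal) - Lam ρ P Q l)) 0 (by simp)
      simp only [Lam_zero, zero_mul, EReal.coe_zero, sub_zero] at this
      exact this
    obtain ⟨c, hc⟩ : ∃ c : ℝ, LamStar ρ P Q D = (c : EReal) :=
      ⟨_, (EReal.coe_toReal htop (fun h => by rw [h] at h0; simp at h0)).symm⟩
    have hc0 : 0 ≤ c := by rw [hc] at h0; exact_mod_cast h0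
    have key : ∀ t, 0 < t →
        ((∫⁻ x, ENNReal.ofReal (LL ρ Q t x) ∂P : ℝ≥0∞) : EReal) ≤ ((c + t * D : ℝ) : EReal) := by
      intro t ht
      have := le_iSup₂ (f := fun (l : ℝ) (_ : l ∈ Iic (0 : ℝ)) =>
        (((l * D : ℝ) : EReal) - Lam ρ P Q l)) (-t) (by simpa using ht.le)
      change _ ≤ LamStar ρ P Q D at this
      rw [Lam_neg hρm hρ0 ht, sub_eq_add_neg, neg_neg, hc] at this
      have h2 := add_le_add_left this ((t * D : ℝ) : EReal)
      have h3 : ((-t * D : ℝ) : EReal) + ((∫⁻ x, ENNReal.ofReal (LL ρ Q t x) ∂P : ℝ≥0∞) : EReal)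
          + ((t * D : ℝ) : EReal) =
          ((∫⁻ x, ENNReal.ofReal (LL ρ Q t x) ∂P : ℝ≥0∞) : EReal) := by
        rw [add_right_comm, ← EReal.coe_add]
        simp
      rw [h3, ← EReal.coe_add] at h2
      exact h2
    have hpos : ∀ t, 0 < t → 0 ≤ c + t * D := by
      intro t ht
      have := (EReal.coe_ennreal_nonneg _).trans (key t ht)
      exact_mod_cast this
    have key' : ∀ t, 0 < t →
        ∫⁻ x, ENNReal.ofReal (LL ρ Q t x) ∂P ≤ ENNReal.ofReal (c + t * D) := by
      intro t ht
      rw [← EReal.coe_ennreal_le_coe_ennreal_iff, EReal.coe_ennreal_ofReal,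
        max_eq_left (hpos t ht)]
      exact key t ht
    have hR : Rrate ρ P Q D ≤ ENNReal.ofReal c := by
      refine hard_dir hρm hρ0 hc0 (fun t ht => ?_) (fun t ht => ?_)
      · refine ⟨(LL_meas hρm t).aestronglyMeasurable, ?_⟩
        rw [hasFiniteIntegral_iff_ofReal (ae_of_all _ fun x => LL_nonneg hρm hρ0 ht.le x)]
        exact (key' t ht).trans_lt ENNReal.ofReal_lt_top
      · rw [integral_eq_lintegral_of_nonneg_ae (ae_of_all _ fun x => LL_nonneg hρm hρ0 ht.le x)
          (LL_meas hρm t).aestronglyMeasurable]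
        exact ENNReal.toReal_le_of_le_ofReal (hpos t ht) (key' t ht)
    have := EReal.coe_ennreal_le_coe_ennreal_iff.2 hR
    rwa [EReal.coe_ennreal_ofReal, max_eq_left hc0, ← hc] at this
  · refine iSup₂_le fun l hl => ?_
    rcases (show l ≤ 0 from hl).eq_or_lt with rfl | hl0
    · simpa [Lam_zero] using EReal.coe_ennreal_nonneg _
    obtain ⟨t, rfl⟩ : ∃ t, l = -t := ⟨-l, by simp⟩
    have ht : 0 < t := by linarith
    rw [Lam_neg hρm hρ0 ht, sub_eq_add_neg, neg_neg]
    by_cases hD : 0 ≤ D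
    · have h1 : ∫⁻ x, ENNReal.ofReal (LL ρ Q t x) ∂P ≤
          Rrate ρ P Q D + ENNReal.ofReal (t * D) := by
        rw [Rrate, ENNReal.iInf_add]
        refine le_iInf fun W => ?_
        by_cases hW : W ∈ distSet ρ P D
        · simpa [hW] using easy_dir (Q := Q) hρm hρ0 ht hW
        · simp [hW]
      have h2 := EReal.coe_ennreal_le_coe_ennreal_iff.2 h1
      rw [EReal.coe_ennreal_add, EReal.coe_ennreal_ofReal, max_eq_left (by positivity)] at h2
      have h3 := add_le_add_left h2 ((-t * D : ℝ) : EReal)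
      rw [add_assoc, ← EReal.coe_add] at h3
      rw [add_comm]
      simpa using h3
    · have : Rrate ρ P Q D = ⊤ := by
        rw [Rrate]
        refine iInf₂_eq_top.2 fun W hW => absurd ?_ hD
        have := (EReal.coe_ennreal_nonneg _).trans hW.2.2
        exact_mod_cast this
      rw [this]
      simp


end
end

section
/- Suppose λ ↦ Λ(P,Q,λ) is finite on (−∞,0]. Then Λ(P,Q,·) is nonpositive and continuously differentiable on (−∞,0), with lim_{λ↑0} Λ(P,Q,λ) = Λ(P,Q,0) = 0 and derivative Λ'(λ) = E_X[ E_Y(ρ(X,Y) e^{λρ(X,Y)}) / E_Y(e^{λρ(X,Y)}) ] for λ < 0. Moreover Λ' is finite, nonnegative and nondecreasing on (−∞,0), with lim_{λ↓−∞} Λ'(λ) = E ρ_Q(X) and lim_{λ↑0} Λ'(λ) = E ρ(X,Y); and if E ρ_Q(X) < E ρ(X,Y), then Λ(P,Q,·) is strictly convex on (−∞,0). -/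
open MeasureTheory Filter Set Topology Classical
open scoped ENNReal NNReal

noncomputable section

open ProbabilityTheory in
theorem aux_intExp {T : Type*} [MeasurableSpace T] (Q : Measure T) [IsProbabilityMeasure Q]
    (f : T → ℝ) (hf : Measurable f) (h0 : ∀ y, 0 ≤ f y) {l : ℝ} (hl : l ≤ 0) :
    Integrable (fun y => Real.exp (l * f y)) Q := by
  refine Integrable.of_bound (C := 1) (by fun_prop) (Eventually.of_forall fun y => ?_)
  rw [Real.norm_eq_abs, abs_of_pos (Real.exp_pos _), Real.exp_le_one_iff]
  exact mul_nonpos_of_nonpos_of_nonneg hl (h0 y)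

open ProbabilityTheory in
theorem aux_mem {T : Type*} [MeasurableSpace T] (Q : Measure T) [IsProbabilityMeasure Q]
    (f : T → ℝ) (hf : Measurable f) (h0 : ∀ y, 0 ≤ f y) {l : ℝ} (hl : l < 0) :
    l ∈ interior (integrableExpSet f Q) := by
  have : Iio (0:ℝ) ⊆ interior (integrableExpSet f Q) := by
    apply interior_maximal _ isOpen_Iio
    intro x hx
    exact aux_intExp Q f hf h0 (le_of_lt hx)
  exact this hl

open ProbabilityTheory in
theorem aux_mgf_pos {T : Type*} [MeasurableSpace T] (Q : Measure T) [IsProbabilityMeasure Q]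
    (f : T → ℝ) (hf : Measurable f) (h0 : ∀ y, 0 ≤ f y) {l : ℝ} (hl : l ≤ 0) :
    0 < mgf f Q l := mgf_pos (aux_intExp Q f hf h0 hl)

open ProbabilityTheory in
theorem aux_mgf_le {T : Type*} [MeasurableSpace T] (Q : Measure T) [IsProbabilityMeasure Q]
    (f : T → ℝ) (hf : Measurable f) (h0 : ∀ y, 0 ≤ f y) {l m : ℝ} (hlm : l ≤ m) (hl : m ≤ 0) :
    mgf f Q l ≤ mgf f Q m := by
  apply integral_mono (aux_intExp Q f hf h0 (hlm.trans hl)) (aux_intExp Q f hf h0 hl)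
  intro y
  exact Real.exp_le_exp.2 (mul_le_mul_of_nonneg_right hlm (h0 y))

open ProbabilityTheory in
theorem aux_cgf_le {T : Type*} [MeasurableSpace T] (Q : Measure T) [IsProbabilityMeasure Q]
    (f : T → ℝ) (hf : Measurable f) (h0 : ∀ y, 0 ≤ f y) {l m : ℝ} (hlm : l ≤ m) (hl : m ≤ 0) :
    cgf f Q l ≤ cgf f Q m :=
  Real.log_le_log (aux_mgf_pos Q f hf h0 (hlm.trans hl)) (aux_mgf_le Q f hf h0 hlm hl)

open ProbabilityTheory in
theorem aux_cgf_nonpos {T : Type*} [MeasurableSpace T] (Q : Measure T) [IsProbabilityMeasure Q]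
    (f : T → ℝ) (hf : Measurable f) (h0 : ∀ y, 0 ≤ f y) {l : ℝ} (hl : l ≤ 0) :
    cgf f Q l ≤ 0 := by
  simpa using aux_cgf_le Q f hf h0 hl le_rfl

open ProbabilityTheory in
theorem aux_mgf_tendsto {T : Type*} [MeasurableSpace T] (Q : Measure T) [IsProbabilityMeasure Q]
    (f : T → ℝ) (hf : Measurable f) (h0 : ∀ y, 0 ≤ f y) :
    Tendsto (mgf f Q) (𝓝[≤] 0) (𝓝 1) := by
  have h1 : (1:ℝ) = ∫ y, Real.exp (0 * f y) ∂Q := by simp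
  rw [h1]
  apply tendsto_integral_filter_of_dominated_convergence (fun _ => 1)
  · exact Eventually.of_forall fun l => by fun_prop
  · filter_upwards [self_mem_nhdsWithin] with l hl
    refine Eventually.of_forall fun y => ?_
    rw [Real.norm_eq_abs, abs_of_pos (Real.exp_pos _), Real.exp_le_one_iff]
    exact mul_nonpos_of_nonpos_of_nonneg hl (h0 y)
  · exact integrable_const _
  · refine Eventually.of_forall fun y => ?_
    have : Continuous fun l : ℝ => Real.exp (l * f y) := by fun_prop
    exact (this.tendsto 0).mono_left nhdsWithin_le_nhds

open ProbabilityTheory in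
theorem aux_cgf_tendsto {T : Type*} [MeasurableSpace T] (Q : Measure T) [IsProbabilityMeasure Q]
    (f : T → ℝ) (hf : Measurable f) (h0 : ∀ y, 0 ≤ f y) :
    Tendsto (cgf f Q) (𝓝[≤] 0) (𝓝 0) := by
  have := (aux_mgf_tendsto Q f hf h0).log one_ne_zero
  rw [Real.log_one] at this
  exact this

open ProbabilityTheory in
/-- derivative of the cgf -/
def dC {T : Type*} [MeasurableSpace T] (Q : Measure T) (f : T → ℝ) (l : ℝ) : ℝ :=
  (∫ y, f y * Real.exp (l * f y) ∂Q) / (∫ y, Real.exp (l * f y) ∂Q)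

open ProbabilityTheory in
theorem aux_deriv {T : Type*} [MeasurableSpace T] (Q : Measure T) [IsProbabilityMeasure Q]
    (f : T → ℝ) (hf : Measurable f) (h0 : ∀ y, 0 ≤ f y) {l : ℝ} (hl : l < 0) :
    deriv (cgf f Q) l = dC Q f l := deriv_cgf (aux_mem Q f hf h0 hl)

open ProbabilityTheory in
theorem aux_hasDeriv {T : Type*} [MeasurableSpace T] (Q : Measure T) [IsProbabilityMeasure Q]
    (f : T → ℝ) (hf : Measurable f) (h0 : ∀ y, 0 ≤ f y) {l : ℝ} (hl : l < 0) :
    HasDerivAt (cgf f Q) (dC Q f l) l := by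
  rw [← aux_deriv Q f hf h0 hl]
  exact (analyticAt_cgf (aux_mem Q f hf h0 hl)).differentiableAt.hasDerivAt

open ProbabilityTheory in
theorem aux_hasDeriv2 {T : Type*} [MeasurableSpace T] (Q : Measure T) [IsProbabilityMeasure Q]
    (f : T → ℝ) (hf : Measurable f) (h0 : ∀ y, 0 ≤ f y) {l : ℝ} (hl : l < 0) :
    HasDerivAt (dC Q f) (Var[f; Q.tilted (l * f ·)]) l := by
  rw [variance_tilted_mul (aux_mem Q f hf h0 hl), iteratedDeriv_succ, iteratedDeriv_one]
  have := (analyticAt_cgf (aux_mem Q f hf h0 hl)).deriv.differentiableAt.hasDerivAt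
  refine this.congr_of_eventuallyEq ?_
  filter_upwards [Iio_mem_nhds hl] with m hm
  rw [aux_deriv Q f hf h0 hm]

open ProbabilityTheory in
theorem aux_mono {T : Type*} [MeasurableSpace T] (Q : Measure T) [IsProbabilityMeasure Q]
    (f : T → ℝ) (hf : Measurable f) (h0 : ∀ y, 0 ≤ f y) :
    MonotoneOn (dC Q f) (Iio 0) := by
  apply monotoneOn_of_deriv_nonneg (convex_Iio 0)
  · exact fun l hl => (aux_hasDeriv2 Q f hf h0 hl).continuousAt.continuousWithinAt
  · rw [interior_Iio]
    exact fun l hl => (aux_hasDeriv2 Q f hf h0 hl).differentiableAt.differentiableWithinAt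
  · rw [interior_Iio]
    intro l hl
    rw [(aux_hasDeriv2 Q f hf h0 hl).deriv]
    exact variance_nonneg _ _

open ProbabilityTheory in
theorem aux_const {T : Type*} [MeasurableSpace T] (Q : Measure T) [IsProbabilityMeasure Q]
    (f : T → ℝ) (hf : Measurable f) (h0 : ∀ y, 0 ≤ f y) {l m : ℝ} (hlm : l < m) (hm : m < 0)
    (h : dC Q f l = dC Q f m) : ∃ c, ∀ᵐ y ∂Q, f y = c := by
  obtain ⟨c, hc, hc'⟩ := exists_hasDerivAt_eq_slope (dC Q f)
    (fun l => Var[f; Q.tilted (l * f ·)]) hlm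
    (fun t ht => (aux_hasDeriv2 Q f hf h0 (ht.2.trans_lt hm)).continuousAt.continuousWithinAt)
    (fun t ht => aux_hasDeriv2 Q f hf h0 (ht.2.trans hm))
  rw [h, sub_self, zero_div] at hc'
  have hc0 : c < 0 := hc.2.trans hm
  have := ae_eq_integral_of_variance_eq_zero (memLp_tilted_mul (aux_mem Q f hf h0 hc0) 2) hc'
  exact ⟨_, (absolutelyContinuous_tilted (aux_intExp Q f hf h0 hc0.le)) this⟩

open ProbabilityTheory in
theorem aux_dnonneg {T : Type*} [MeasurableSpace T] (Q : Measure T)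
    (f : T → ℝ) (h0 : ∀ y, 0 ≤ f y) (l : ℝ) : 0 ≤ dC Q f l :=
  div_nonneg (integral_nonneg fun y => mul_nonneg (h0 y) (Real.exp_pos _).le)
    (integral_nonneg fun y => (Real.exp_pos _).le)

open ProbabilityTheory in
theorem aux_slope {T : Type*} [MeasurableSpace T] (Q : Measure T) [IsProbabilityMeasure Q]
    (f : T → ℝ) (hf : Measurable f) (h0 : ∀ y, 0 ≤ f y) {l : ℝ} (hl : l < 0) :
    dC Q f l ≤ cgf f Q l / l := by
  obtain ⟨c, hc, hc'⟩ := exists_hasDerivAt_eq_slope (cgf f Q) (dC Q f) hl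
    (by
      intro t ht
      rcases ht.2.lt_or_eq with h | h
      · exact (aux_hasDeriv Q f hf h0 h).continuousAt.continuousWithinAt
      · subst h
        have := aux_cgf_tendsto Q f hf h0
        unfold ContinuousWithinAt
        rw [cgf_zero]
        exact this.mono_left (nhdsWithin_mono _ fun x hx => hx.2))
    (fun t ht => aux_hasDeriv Q f hf h0 ht.2)
  have := aux_mono Q f hf h0 (show l ∈ Iio 0 from hl) (show c ∈ Iio 0 from hc.2) hc.1.le
  rw [hc', cgf_zero] at this
  rwa [zero_sub, zero_sub, neg_div_neg_eq] at this

open ProbabilityTheory in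
theorem aux_intF {T : Type*} [MeasurableSpace T] (Q : Measure T) [IsProbabilityMeasure Q]
    (f : T → ℝ) (hf : Measurable f) (h0 : ∀ y, 0 ≤ f y) {l : ℝ} (hl : l < 0) :
    Integrable (fun y => f y * Real.exp (l * f y)) Q := by
  simpa using integrable_pow_mul_exp_of_mem_interior_integrableExpSet (aux_mem Q f hf h0 hl) 1

theorem aux_ess_bdd {T : Type*} [MeasurableSpace T] (Q : Measure T) [IsProbabilityMeasure Q]
    (f : T → ℝ) (h0 : ∀ y, 0 ≤ f y) : BddAbove {a | ∀ᵐ y ∂Q, a ≤ f y} := by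
  by_contra hb
  rw [not_bddAbove_iff] at hb
  have : ∀ n : ℕ, ∀ᵐ y ∂Q, (n:ℝ) ≤ f y := by
    intro n
    obtain ⟨a, ha, hna⟩ := hb n
    filter_upwards [ha] with y hy
    exact hna.le.trans hy
  obtain ⟨y, hy⟩ := (ae_all_iff.2 this).exists
  obtain ⟨n, hn⟩ := exists_nat_gt (f y)
  exact absurd (hy n) (not_le.2 hn)

theorem aux_ess_eq {T : Type*} [MeasurableSpace T] (Q : Measure T) 
    (f : T → ℝ) : essInf f Q = sSup {a | ∀ᵐ y ∂Q, a ≤ f y} := by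
  rw [essInf, liminf_eq]

theorem aux_ess_le {T : Type*} [MeasurableSpace T] (Q : Measure T) [IsProbabilityMeasure Q]
    (f : T → ℝ) (h0 : ∀ y, 0 ≤ f y) : ∀ᵐ y ∂Q, essInf f Q ≤ f y := by
  have : ∀ n : ℕ, ∀ᵐ y ∂Q, essInf f Q - 1 / ((n:ℝ) + 1) ≤ f y := by
    intro n
    have hp : (0:ℝ) < 1 / ((n:ℝ) + 1) := by positivity
    have hlt : essInf f Q - 1 / ((n:ℝ) + 1) < sSup {a | ∀ᵐ y ∂Q, a ≤ f y} := by
      rw [← aux_ess_eq]; linarith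
    obtain ⟨a, ha, hlt⟩ := exists_lt_of_lt_csSup
      (show {a | ∀ᵐ y ∂Q, a ≤ f y}.Nonempty from ⟨0, by
        rw [mem_ofPred_eq]; exact Eventually.of_forall h0⟩) hlt
    filter_upwards [show ∀ᵐ y ∂Q, a ≤ f y from ha] with y hy
    exact hlt.le.trans hy
  filter_upwards [ae_all_iff.2 this] with y hy
  have ht := tendsto_one_div_add_atTop_nhds_zero_nat (𝕜 := ℝ)
  have := (tendsto_const_nhds (x := essInf f Q)).sub ht
  rw [sub_zero] at this
  exact le_of_tendsto' this hy

theorem aux_ess_pos {T : Type*} [MeasurableSpace T] (Q : Measure T) [IsProbabilityMeasure Q]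
    (f : T → ℝ) (h0 : ∀ y, 0 ≤ f y) {b : ℝ} (hb : essInf f Q < b) :
    0 < Q.real {y | f y < b} := by
  rw [measureReal_def, ENNReal.toReal_pos_iff]
  refine ⟨?_, measure_lt_top _ _⟩
  rw [pos_iff_ne_zero]
  intro h
  have : b ∈ {a | ∀ᵐ y ∂Q, a ≤ f y} := by
    simp only [mem_ofPred_eq, ae_iff, not_le]
    exact h
  have := le_csSup (aux_ess_bdd Q f h0) this
  rw [← aux_ess_eq] at this
  linarith

theorem aux_ess_nonneg {T : Type*} [MeasurableSpace T] (Q : Measure T) [IsProbabilityMeasure Q]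
    (f : T → ℝ) (h0 : ∀ y, 0 ≤ f y) : 0 ≤ essInf f Q := by
  rw [aux_ess_eq]
  exact le_csSup (aux_ess_bdd Q f h0) (by rw [mem_ofPred_eq]; exact Eventually.of_forall h0)

open ProbabilityTheory in
theorem aux_d_ge {T : Type*} [MeasurableSpace T] (Q : Measure T) [IsProbabilityMeasure Q]
    (f : T → ℝ) (hf : Measurable f) (h0 : ∀ y, 0 ≤ f y) {l : ℝ} (hl : l < 0) :
    essInf f Q ≤ dC Q f l := by
  have hp := aux_mgf_pos Q f hf h0 hl.le
  change 0 < ∫ y, Real.exp (l * f y) ∂Q at hp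
  unfold dC
  rw [le_div_iff₀ hp, ← integral_const_mul]
  apply integral_mono_ae ((aux_intExp Q f hf h0 hl.le).const_mul _) (aux_intF Q f hf h0 hl)
  filter_upwards [aux_ess_le Q f h0] with y hy
  exact mul_le_mul_of_nonneg_right hy (Real.exp_pos _).le

open ProbabilityTheory in
theorem aux_d_le {T : Type*} [MeasurableSpace T] (Q : Measure T) [IsProbabilityMeasure Q]
    (f : T → ℝ) (hf : Measurable f) (h0 : ∀ y, 0 ≤ f y) {l b : ℝ} (hl : l < 0)
    (hb : essInf f Q < b) :
    dC Q f l ≤ Real.log (Q.real {y | f y < b}) / l + b := by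
  refine (aux_slope Q f hf h0 hl).trans ?_
  have hq := aux_ess_pos Q f h0 hb
  have hms : MeasurableSet {y | f y < b} := measurableSet_lt hf measurable_const
  have h1 : Q.real {y | f y < b} * Real.exp (l * b) ≤ mgf f Q l := by
    calc Q.real {y | f y < b} * Real.exp (l * b)
        = ∫ y in {y | f y < b}, Real.exp (l * b) ∂Q := by simp
      _ ≤ ∫ y in {y | f y < b}, Real.exp (l * f y) ∂Q := by
          apply setIntegral_mono_on (integrable_const _)
            (aux_intExp Q f hf h0 hl.le).integrableOn hms
          intro y hy
          exact Real.exp_le_exp.2 (mul_le_mul_of_nonpos_left (le_of_lt hy) hl.le)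
      _ ≤ _ := setIntegral_le_integral (aux_intExp Q f hf h0 hl.le)
          (Eventually.of_forall fun y => (Real.exp_pos _).le)
  have h2 := Real.log_le_log (mul_pos hq (Real.exp_pos _)) h1
  rw [Real.log_mul hq.ne' (Real.exp_pos _).ne', Real.log_exp] at h2
  rw [div_add' _ _ _ hl.ne]
  apply div_le_div_of_nonpos_of_le hl.le
  rw [mul_comm b]
  exact h2

open ProbabilityTheory in
theorem aux_d_atBot {T : Type*} [MeasurableSpace T] (Q : Measure T) [IsProbabilityMeasure Q]
    (f : T → ℝ) (hf : Measurable f) (h0 : ∀ y, 0 ≤ f y) :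
    Tendsto (dC Q f) atBot (𝓝 (essInf f Q)) := by
  rw [tendsto_order]
  constructor
  · intro a ha
    filter_upwards [Iio_mem_atBot 0] with l hl
    exact ha.trans_le (aux_d_ge Q f hf h0 hl)
  · intro a ha
    obtain ⟨b, hb, hba⟩ := exists_between ha
    have ht : Tendsto (fun l : ℝ => Real.log (Q.real {y | f y < b}) / l + b) atBot (𝓝 (0 + b)) :=
      (tendsto_const_nhds.div_atBot tendsto_id).add tendsto_const_nhds
    rw [zero_add] at ht
    filter_upwards [Iio_mem_atBot 0, ht.eventually (gt_mem_nhds hba)] with l hl h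
    exact (aux_d_le Q f hf h0 hl hb).trans_lt h

/-- sequence increasing to zero -/
def seqL (n : ℕ) : ℝ := -(1 / ((n:ℝ) + 1))

theorem seqL_neg (n : ℕ) : seqL n < 0 := by
  unfold seqL
  have : (0:ℝ) < 1 / ((n:ℝ) + 1) := by positivity
  linarith

theorem seqL_mono : Monotone seqL := by
  intro a b h
  unfold seqL
  exact neg_le_neg (Nat.one_div_le_one_div h)

theorem seqL_tendsto : Tendsto seqL atTop (𝓝[<] 0) := by
  rw [tendsto_nhdsWithin_iff]
  refine ⟨?_, Eventually.of_forall seqL_neg⟩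
  have := (tendsto_one_div_add_atTop_nhds_zero_nat (𝕜 := ℝ)).neg
  rw [neg_zero] at this
  exact this

open ProbabilityTheory in
theorem aux_d_zero {T : Type*} [MeasurableSpace T] (Q : Measure T) [IsProbabilityMeasure Q]
    (f : T → ℝ) (hf : Measurable f) (h0 : ∀ y, 0 ≤ f y) :
    Tendsto (fun n => ENNReal.ofReal (dC Q f (seqL n))) atTop
      (𝓝 (∫⁻ y, ENNReal.ofReal (f y) ∂Q)) := by
  have h1 : ∀ n, ENNReal.ofReal (dC Q f (seqL n)) =
      (∫⁻ y, ENNReal.ofReal (f y * Real.exp (seqL n * f y)) ∂Q) /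
        ENNReal.ofReal (mgf f Q (seqL n)) := by
    intro n
    rw [← ofReal_integral_eq_lintegral_ofReal (aux_intF Q f hf h0 (seqL_neg n))
      (Eventually.of_forall fun y => mul_nonneg (h0 y) (Real.exp_pos _).le),
      ← ENNReal.ofReal_div_of_pos (aux_mgf_pos Q f hf h0 (seqL_neg n).le)]
    rfl
  simp_rw [h1]
  have h2 : Tendsto (fun n => ∫⁻ y, ENNReal.ofReal (f y * Real.exp (seqL n * f y)) ∂Q) atTop
      (𝓝 (∫⁻ y, ENNReal.ofReal (f y) ∂Q)) := by
    apply lintegral_tendsto_of_tendsto_of_monotone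
    · intro n; fun_prop
    · refine Eventually.of_forall fun y a b hab => ?_
      apply ENNReal.ofReal_le_ofReal
      exact mul_le_mul_of_nonneg_left (Real.exp_le_exp.2
        (mul_le_mul_of_nonneg_right (seqL_mono hab) (h0 y))) (h0 y)
    · refine Eventually.of_forall fun y => ?_
      have hc : Continuous fun l : ℝ => ENNReal.ofReal (f y * Real.exp (l * f y)) :=
        ENNReal.continuous_ofReal.comp (by fun_prop)
      have := (hc.tendsto 0).comp (seqL_tendsto.mono_right nhdsWithin_le_nhds)
      simpa [Function.comp_def] using this
  have h3 : Tendsto (fun n => ENNReal.ofReal (mgf f Q (seqL n))) atTop (𝓝 1) := by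
    have := (aux_mgf_tendsto Q f hf h0).comp
      (seqL_tendsto.mono_right (nhdsWithin_mono _ Iio_subset_Iic_self))
    have := ENNReal.tendsto_ofReal this
    simpa [Function.comp_def] using this
  have := ENNReal.Tendsto.div h2 (Or.inr one_ne_zero) h3 (Or.inl ENNReal.one_ne_top)
  simpa using this

section two
variable {S T : Type*} [MeasurableSpace S] [MeasurableSpace T]

open ProbabilityTheory in
theorem two_meas_g (ρ : S × T → ℝ) (hρm : Measurable ρ) (Q : Measure T) [IsProbabilityMeasure Q]
    (l : ℝ) : Measurable fun x => cgf (fun y => ρ (x, y)) Q l := by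
  apply Real.measurable_log.comp
  have : StronglyMeasurable (fun z : S × T => Real.exp (l * ρ z)) :=
    Measurable.stronglyMeasurable (by fun_prop)
  exact this.integral_prod_right.measurable

theorem two_meas_d (ρ : S × T → ℝ) (hρm : Measurable ρ) (Q : Measure T) [IsProbabilityMeasure Q]
    (l : ℝ) : Measurable fun x => dC Q (fun y => ρ (x, y)) l := by
  have h1 : StronglyMeasurable (fun z : S × T => Real.exp (l * ρ z)) :=
    Measurable.stronglyMeasurable (by fun_prop)
  have h2 : StronglyMeasurable (fun z : S × T => ρ z * Real.exp (l * ρ z)) :=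
    Measurable.stronglyMeasurable (by fun_prop)
  exact h2.integral_prod_right.measurable.div h1.integral_prod_right.measurable

open ProbabilityTheory in
theorem two_negLog (ρ : S × T → ℝ) (hρm : Measurable ρ) (hρ0 : ∀ z, 0 ≤ ρ z)
    (Q : Measure T) [IsProbabilityMeasure Q] {l : ℝ} (hl : l ≤ 0) (x : S) :
    negLog (∫⁻ y, ENNReal.ofReal (Real.exp (l * ρ (x, y))) ∂Q) =
      ENNReal.ofReal (-cgf (fun y => ρ (x, y)) Q l) := by
  have hf : Measurable fun y => ρ (x, y) := by fun_prop
  have h0 : ∀ y, 0 ≤ (fun y => ρ (x, y)) y := fun y => hρ0 _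
  have hp := aux_mgf_pos Q _ hf h0 hl
  rw [← ofReal_integral_eq_lintegral_ofReal (aux_intExp Q _ hf h0 hl)
    (Eventually.of_forall fun y => (Real.exp_pos _).le)]
  change negLog (ENNReal.ofReal (mgf (fun y => ρ (x, y)) Q l)) = _
  rw [negLog, if_neg (by simpa using hp), ENNReal.toReal_ofReal hp.le]
  rfl

open ProbabilityTheory in
theorem two_lam (ρ : S × T → ℝ) (hρm : Measurable ρ) (hρ0 : ∀ z, 0 ≤ ρ z)
    (P : Measure S) (Q : Measure T) [IsProbabilityMeasure Q] {l : ℝ} (hl : l < 0) :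
    Lam ρ P Q l = -((∫⁻ x, ENNReal.ofReal (-cgf (fun y => ρ (x, y)) Q l) ∂P : ℝ≥0∞) : EReal) := by
  rw [Lam, if_neg (not_le.2 hl)]
  simp_rw [two_negLog ρ hρm hρ0 Q hl.le]

open ProbabilityTheory in
theorem two_int_g (ρ : S × T → ℝ) (hρm : Measurable ρ) (hρ0 : ∀ z, 0 ≤ ρ z)
    (P : Measure S) (Q : Measure T) [IsProbabilityMeasure Q]
    (hfin : ∀ l ≤ (0 : ℝ), Lam ρ P Q l ≠ ⊥) {l : ℝ} (hl : l < 0) :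
    Integrable (fun x => cgf (fun y => ρ (x, y)) Q l) P := by
  have h := hfin l hl.le
  rw [two_lam ρ hρm hρ0 P Q hl] at h
  have h' : (∫⁻ x, ENNReal.ofReal (-cgf (fun y => ρ (x, y)) Q l) ∂P) ≠ ⊤ := by
    intro h2; rw [h2] at h; simp at h
  have hn : Integrable (fun x => -cgf (fun y => ρ (x, y)) Q l) P := by
    rw [← lintegral_ofReal_ne_top_iff_integrable (f := fun x => -cgf (fun y => ρ (x, y)) Q l)
      (two_meas_g ρ hρm Q l).neg.aestronglyMeasurable]
    · exact h'
    · exact Eventually.of_forall fun x => neg_nonneg.2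
        (aux_cgf_nonpos Q _ (by fun_prop) (fun y => hρ0 _) hl.le)
  simpa using hn.neg

open ProbabilityTheory in
theorem two_lam' (ρ : S × T → ℝ) (hρm : Measurable ρ) (hρ0 : ∀ z, 0 ≤ ρ z)
    (P : Measure S) (Q : Measure T) [IsProbabilityMeasure Q]
    (hfin : ∀ l ≤ (0 : ℝ), Lam ρ P Q l ≠ ⊥) {l : ℝ} (hl : l < 0) :
    Lam ρ P Q l = ((∫ x, cgf (fun y => ρ (x, y)) Q l ∂P : ℝ) : EReal) := by
  have hn : ∀ x, 0 ≤ -cgf (fun y => ρ (x, y)) Q l := fun x => neg_nonneg.2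
        (aux_cgf_nonpos Q _ (by fun_prop) (fun y => hρ0 _) hl.le)
  rw [two_lam ρ hρm hρ0 P Q hl, ← ofReal_integral_eq_lintegral_ofReal
    (f := fun x => -cgf (fun y => ρ (x, y)) Q l) (two_int_g ρ hρm hρ0 P Q hfin hl).neg (Eventually.of_forall hn),
    EReal.coe_ennreal_ofReal, max_eq_left (integral_nonneg hn)]
  simp only [integral_neg, EReal.coe_neg, neg_neg]

open ProbabilityTheory in
theorem two_int_d (ρ : S × T → ℝ) (hρm : Measurable ρ) (hρ0 : ∀ z, 0 ≤ ρ z)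
    (P : Measure S) (Q : Measure T) [IsProbabilityMeasure Q]
    (hfin : ∀ l ≤ (0 : ℝ), Lam ρ P Q l ≠ ⊥) {l : ℝ} (hl : l < 0) :
    Integrable (fun x => dC Q (fun y => ρ (x, y)) l) P := by
  refine ((two_int_g ρ hρm hρ0 P Q hfin hl).div_const l).mono'
    (two_meas_d ρ hρm Q l).aestronglyMeasurable (Eventually.of_forall fun x => ?_)
  rw [Real.norm_eq_abs, abs_of_nonneg (aux_dnonneg Q _ (fun y => hρ0 _) l)]
  exact aux_slope Q _ (by fun_prop) (fun y => hρ0 _) hl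

theorem two_bound (ρ : S × T → ℝ) (hρm : Measurable ρ) (hρ0 : ∀ z, 0 ≤ ρ z)
    (Q : Measure T) [IsProbabilityMeasure Q] {l m : ℝ} (hlm : l ≤ m) (hm : m < 0) (x : S) :
    ‖dC Q (fun y => ρ (x, y)) l‖ ≤ dC Q (fun y => ρ (x, y)) m := by
  rw [Real.norm_eq_abs, abs_of_nonneg (aux_dnonneg Q _ (fun y => hρ0 _) l)]
  exact aux_mono Q _ (by fun_prop) (fun y => hρ0 _) (show l ∈ Iio 0 from hlm.trans_lt hm)
    (show m ∈ Iio 0 from hm) hlm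

open ProbabilityTheory in
theorem two_hasDeriv (ρ : S × T → ℝ) (hρm : Measurable ρ) (hρ0 : ∀ z, 0 ≤ ρ z)
    (P : Measure S) (Q : Measure T) [IsProbabilityMeasure Q]
    (hfin : ∀ l ≤ (0 : ℝ), Lam ρ P Q l ≠ ⊥) {l : ℝ} (hl : l < 0) :
    HasDerivAt (fun t => (Lam ρ P Q t).toReal) (LamD ρ P Q l) l := by
  have hl2 : l < l / 2 := by linarith
  have hl3 : l / 2 < 0 := by linarith
  have := (hasDerivAt_integral_of_dominated_loc_of_deriv_le (μ := P) (x₀ := l) (s := Iio (l / 2))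
    (F := fun t x => cgf (fun y => ρ (x, y)) Q t) (F' := fun t x => dC Q (fun y => ρ (x, y)) t)
    (bound := fun x => dC Q (fun y => ρ (x, y)) (l / 2))
    (Iio_mem_nhds hl2) (Eventually.of_forall fun t => (two_meas_g ρ hρm Q t).aestronglyMeasurable)
    (two_int_g ρ hρm hρ0 P Q hfin hl) (two_meas_d ρ hρm Q l).aestronglyMeasurable
    (Eventually.of_forall fun x t ht => two_bound ρ hρm hρ0 Q (le_of_lt ht) hl3 x)
    (two_int_d ρ hρm hρ0 P Q hfin hl3)
    (Eventually.of_forall fun x t ht => aux_hasDeriv Q _ (by fun_prop) (fun y => hρ0 _)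
      (lt_trans ht hl3))).2
  refine this.congr_of_eventuallyEq ?_
  filter_upwards [Iio_mem_nhds hl] with t ht
  rw [two_lam' ρ hρm hρ0 P Q hfin ht, EReal.toReal_coe]

theorem two_cont (ρ : S × T → ℝ) (hρm : Measurable ρ) (hρ0 : ∀ z, 0 ≤ ρ z)
    (P : Measure S) (Q : Measure T) [IsProbabilityMeasure Q]
    (hfin : ∀ l ≤ (0 : ℝ), Lam ρ P Q l ≠ ⊥) : ContinuousOn (LamD ρ P Q) (Iio (0 : ℝ)) := by
  intro l hl
  have hl : l < 0 := hl
  have hl2 : l < l / 2 := by linarith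
  have hl3 : l / 2 < 0 := by linarith
  apply ContinuousAt.continuousWithinAt
  change ContinuousAt (fun t => ∫ x, dC Q (fun y => ρ (x, y)) t ∂P) l
  refine continuousAt_of_dominated (bound := fun x => dC Q (fun y => ρ (x, y)) (l / 2))
    (Eventually.of_forall fun t => (two_meas_d ρ hρm Q t).aestronglyMeasurable) ?_
    (two_int_d ρ hρm hρ0 P Q hfin hl3)
    (Eventually.of_forall fun x => (aux_hasDeriv2 Q _ (by fun_prop) (fun y => hρ0 _)
      hl).continuousAt)
  filter_upwards [Iio_mem_nhds hl2] with t ht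
  exact Eventually.of_forall fun x => two_bound ρ hρm hρ0 Q (le_of_lt ht) hl3 x

theorem two_mono (ρ : S × T → ℝ) (hρm : Measurable ρ) (hρ0 : ∀ z, 0 ≤ ρ z)
    (P : Measure S) (Q : Measure T) [IsProbabilityMeasure Q]
    (hfin : ∀ l ≤ (0 : ℝ), Lam ρ P Q l ≠ ⊥) : MonotoneOn (LamD ρ P Q) (Iio (0 : ℝ)) := by
  intro l hl m hm hlm
  exact integral_mono (two_int_d ρ hρm hρ0 P Q hfin hl) (two_int_d ρ hρm hρ0 P Q hfin hm)
    fun x => aux_mono Q _ (by fun_prop) (fun y => hρ0 _) hl hm hlm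

theorem two_atBot (ρ : S × T → ℝ) (hρm : Measurable ρ) (hρ0 : ∀ z, 0 ≤ ρ z)
    (P : Measure S) (Q : Measure T) [IsProbabilityMeasure Q]
    (hfin : ∀ l ≤ (0 : ℝ), Lam ρ P Q l ≠ ⊥) :
    Tendsto (fun l => ((LamD ρ P Q l : ℝ) : EReal)) atBot
      (𝓝 ((∫⁻ x, ENNReal.ofReal (rhoQ ρ Q x) ∂P : ℝ≥0∞) : EReal)) := by
  have hlim : ∀ x, Tendsto (fun l => dC Q (fun y => ρ (x, y)) l) atBot (𝓝 (rhoQ ρ Q x)) :=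
    fun x => aux_d_atBot Q _ (by fun_prop) (fun y => hρ0 _)
  have hnn : ∀ x, 0 ≤ rhoQ ρ Q x := fun x => aux_ess_nonneg Q _ (fun y => hρ0 _)
  have hi1 := two_int_d ρ hρm hρ0 P Q hfin (l := -1) (by norm_num)
  have hint : Integrable (rhoQ ρ Q) P := by
    refine hi1.mono' (aestronglyMeasurable_of_tendsto_ae atBot
      (fun t => (two_meas_d ρ hρm Q t).aestronglyMeasurable) (Eventually.of_forall hlim))
      (Eventually.of_forall fun x => ?_)
    rw [Real.norm_eq_abs, abs_of_nonneg (hnn x)]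
    exact aux_d_ge Q _ (by fun_prop) (fun y => hρ0 _) (by norm_num)
  rw [← ofReal_integral_eq_lintegral_ofReal hint (Eventually.of_forall hnn),
    EReal.coe_ennreal_ofReal, max_eq_left (integral_nonneg hnn)]
  apply (continuous_coe_real_ereal.tendsto _).comp
  refine tendsto_integral_filter_of_dominated_convergence _
    (Eventually.of_forall fun t => (two_meas_d ρ hρm Q t).aestronglyMeasurable) ?_ hi1
    (Eventually.of_forall hlim)
  filter_upwards [Iic_mem_atBot (-1)] with t ht
  exact Eventually.of_forall fun x => two_bound ρ hρm hρ0 Q ht (by norm_num) x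

theorem two_zero (ρ : S × T → ℝ) (hρm : Measurable ρ) (hρ0 : ∀ z, 0 ≤ ρ z)
    (P : Measure S) (Q : Measure T) [IsProbabilityMeasure Q]
    (hfin : ∀ l ≤ (0 : ℝ), Lam ρ P Q l ≠ ⊥) :
    Tendsto (fun l => ((LamD ρ P Q l : ℝ) : EReal)) (𝓝[<] (0 : ℝ))
      (𝓝 ((DavePQ ρ P Q : ℝ≥0∞) : EReal)) := by
  have hseq : Tendsto (fun n => ((LamD ρ P Q (seqL n) : ℝ) : EReal)) atTop
      (𝓝 ((DavePQ ρ P Q : ℝ≥0∞) : EReal)) := by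
    have h1 : ∀ n, ((LamD ρ P Q (seqL n) : ℝ) : EReal) =
        ((∫⁻ x, ENNReal.ofReal (dC Q (fun y => ρ (x, y)) (seqL n)) ∂P : ℝ≥0∞) : EReal) := by
      intro n
      have hn : ∀ x, 0 ≤ dC Q (fun y => ρ (x, y)) (seqL n) :=
        fun x => aux_dnonneg Q _ (fun y => hρ0 _) _
      rw [← ofReal_integral_eq_lintegral_ofReal (two_int_d ρ hρm hρ0 P Q hfin (seqL_neg n))
        (Eventually.of_forall hn), EReal.coe_ennreal_ofReal, max_eq_left (integral_nonneg hn)]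
      rfl
    simp_rw [h1]
    apply (continuous_coe_ennreal_ereal.tendsto _).comp
    have h2 : DavePQ ρ P Q = ∫⁻ x, ∫⁻ y, ENNReal.ofReal (ρ (x, y)) ∂Q ∂P :=
      lintegral_prod _ (by fun_prop)
    rw [h2]
    apply lintegral_tendsto_of_tendsto_of_monotone
    · exact fun n => (two_meas_d ρ hρm Q _).ennreal_ofReal.aemeasurable
    · refine Eventually.of_forall fun x a b hab => ENNReal.ofReal_le_ofReal ?_
      exact aux_mono Q _ (by fun_prop) (fun y => hρ0 _) (seqL_neg a) (seqL_neg b) (seqL_mono hab)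
    · exact Eventually.of_forall fun x => aux_d_zero Q _ (by fun_prop) (fun y => hρ0 _)
  have hmono : MonotoneOn (fun l => ((LamD ρ P Q l : ℝ) : EReal)) (Iio 0) :=
    fun a ha b hb hab => EReal.coe_le_coe_iff.2 (two_mono ρ hρm hρ0 P Q hfin ha hb hab)
  have ht := hmono.tendsto_nhdsLT (OrderTop.bddAbove _)
  rwa [tendsto_nhds_unique hseq (ht.comp seqL_tendsto)]

open ProbabilityTheory in
theorem two_lam_zero (ρ : S × T → ℝ) (hρm : Measurable ρ) (hρ0 : ∀ z, 0 ≤ ρ z)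
    (P : Measure S) (Q : Measure T) [IsProbabilityMeasure Q]
    (hfin : ∀ l ≤ (0 : ℝ), Lam ρ P Q l ≠ ⊥) :
    Tendsto (fun l => Lam ρ P Q l) (𝓝[<] (0 : ℝ)) (𝓝 (0 : EReal)) := by
  have h : Tendsto (fun l => ∫ x, cgf (fun y => ρ (x, y)) Q l ∂P) (𝓝[<] (0 : ℝ))
      (𝓝 (∫ _x, (0:ℝ) ∂P)) := by
    refine tendsto_integral_filter_of_dominated_convergence
      (fun x => -cgf (fun y => ρ (x, y)) Q (-1))
      (Eventually.of_forall fun t => (two_meas_g ρ hρm Q t).aestronglyMeasurable) ?_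
      (two_int_g ρ hρm hρ0 P Q hfin (by norm_num)).neg
      (Eventually.of_forall fun x => (aux_cgf_tendsto Q _ (by fun_prop) (fun y => hρ0 _)).mono_left
        (nhdsWithin_mono _ Iio_subset_Iic_self))
    filter_upwards [Ioo_mem_nhdsLT (show (-1:ℝ) < 0 by norm_num)] with t ht
    refine Eventually.of_forall fun x => ?_
    rw [Real.norm_eq_abs, abs_of_nonpos (aux_cgf_nonpos Q _ (by fun_prop) (fun y => hρ0 _) ht.2.le)]
    exact neg_le_neg (aux_cgf_le Q _ (by fun_prop) (fun y => hρ0 _) ht.1.le ht.2.le)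
  rw [integral_zero] at h
  have h2 := (continuous_coe_real_ereal.tendsto _).comp h
  rw [EReal.coe_zero] at h2
  refine h2.congr' ?_
  filter_upwards [self_mem_nhdsWithin] with l hl
  exact (two_lam' ρ hρm hρ0 P Q hfin hl).symm

theorem two_strict (ρ : S × T → ℝ) (hρm : Measurable ρ) (hρ0 : ∀ z, 0 ≤ ρ z)
    (P : Measure S) (Q : Measure T) [IsProbabilityMeasure P] [IsProbabilityMeasure Q]
    (hfin : ∀ l ≤ (0 : ℝ), Lam ρ P Q l ≠ ⊥)
    (hlt : (∫⁻ x, ENNReal.ofReal (rhoQ ρ Q x) ∂P) < DavePQ ρ P Q) :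
    StrictMonoOn (LamD ρ P Q) (Iio 0) := by
  intro l hl m hm hlm
  refine lt_of_le_of_ne (two_mono ρ hρm hρ0 P Q hfin hl hm hlm.le) fun heq => hlt.ne ?_
  have h1 := (integral_eq_iff_of_ae_le (two_int_d ρ hρm hρ0 P Q hfin hl)
    (two_int_d ρ hρm hρ0 P Q hfin hm) (Eventually.of_forall
      fun x => aux_mono Q _ (by fun_prop) (fun y => hρ0 _) hl hm hlm.le)).1 heq
  have h2 : DavePQ ρ P Q = ∫⁻ x, ∫⁻ y, ENNReal.ofReal (ρ (x, y)) ∂Q ∂P :=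
    lintegral_prod _ (by fun_prop)
  rw [h2]
  apply lintegral_congr_ae
  filter_upwards [h1] with x hx
  obtain ⟨c, hc⟩ := aux_const Q (fun y => ρ (x, y)) (by fun_prop) (fun y => hρ0 _) hlm hm hx
  have h3 : rhoQ ρ Q x = c := by
    rw [rhoQ, essInf_congr_ae (g := fun _ => c) hc, essInf_const']
  have h4 : ∫⁻ y, ENNReal.ofReal (ρ (x, y)) ∂Q = ∫⁻ _y, ENNReal.ofReal c ∂Q := by
    apply lintegral_congr_ae
    filter_upwards [hc] with y hy
    rw [hy]
  rw [h3, h4]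
  simp

end two

/-- regularity of `Λ(P,Q,·)` on `(-∞,0]` assuming it is finite there:
nonpositivity, `Λ(0)=0` and continuity from the left at `0`, continuous differentiability
on `(-∞,0)` with the explicit derivative `Λ'`, finiteness (integrability), nonnegativity and
monotonicity of `Λ'`, the limits `Λ'(λ) → Eρ_Q(X)` as `λ → -∞` and `Λ'(λ) → Eρ(X,Y)` as
`λ ↑ 0`, and strict convexity when `Eρ_Q(X) < Eρ(X,Y)`. -/
theorem stmt4 {S T : Type*} [MeasurableSpace S] [StandardBorelSpace S]
    [MeasurableSpace T] [StandardBorelSpace T]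
    (ρ : S × T → ℝ) (hρm : Measurable ρ) (hρ0 : ∀ z, 0 ≤ ρ z)
    (P : Measure S) (Q : Measure T) [IsProbabilityMeasure P] [IsProbabilityMeasure Q]
    (hfin : ∀ l ≤ (0 : ℝ), Lam ρ P Q l ≠ ⊥) :
    (∀ l < (0 : ℝ), Lam ρ P Q l ≤ 0) ∧
    Lam ρ P Q 0 = 0 ∧
    Tendsto (fun l => Lam ρ P Q l) (𝓝[<] (0 : ℝ)) (𝓝 (0 : EReal)) ∧
    (∀ l < (0 : ℝ), HasDerivAt (fun t => (Lam ρ P Q t).toReal) (LamD ρ P Q l) l) ∧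
    ContinuousOn (LamD ρ P Q) (Iio (0 : ℝ)) ∧
    (∀ l < (0 : ℝ), Integrable (fun x =>
      (∫ y, ρ (x, y) * Real.exp (l * ρ (x, y)) ∂Q) /
        (∫ y, Real.exp (l * ρ (x, y)) ∂Q)) P) ∧
    (∀ l < (0 : ℝ), 0 ≤ LamD ρ P Q l) ∧
    MonotoneOn (LamD ρ P Q) (Iio (0 : ℝ)) ∧
    Tendsto (fun l => ((LamD ρ P Q l : ℝ) : EReal)) atBot
      (𝓝 ((∫⁻ x, ENNReal.ofReal (rhoQ ρ Q x) ∂P : ℝ≥0∞) : EReal)) ∧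
    Tendsto (fun l => ((LamD ρ P Q l : ℝ) : EReal)) (𝓝[<] (0 : ℝ))
      (𝓝 ((DavePQ ρ P Q : ℝ≥0∞) : EReal)) ∧
    ((∫⁻ x, ENNReal.ofReal (rhoQ ρ Q x) ∂P) < DavePQ ρ P Q →
      StrictConvexOn ℝ (Iio (0 : ℝ)) fun t => (Lam ρ P Q t).toReal) := by
  refine ⟨fun l hl => ?_, ?_, two_lam_zero ρ hρm hρ0 P Q hfin,
    fun l hl => two_hasDeriv ρ hρm hρ0 P Q hfin hl, two_cont ρ hρm hρ0 P Q hfin,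
    fun l hl => two_int_d ρ hρm hρ0 P Q hfin hl, fun l _ => ?_, two_mono ρ hρm hρ0 P Q hfin,
    two_atBot ρ hρm hρ0 P Q hfin, two_zero ρ hρm hρ0 P Q hfin, fun hlt => ?_⟩
  · rw [two_lam ρ hρm hρ0 P Q hl, EReal.neg_le, neg_zero]
    exact EReal.coe_ennreal_nonneg _
  · simp [Lam, posLog]
  · exact integral_nonneg fun x => aux_dnonneg Q (fun y => ρ (x, y)) (fun y => hρ0 _) l
  · apply StrictMonoOn.strictConvexOn_of_deriv (convex_Iio 0)
    · exact fun l hl => (two_hasDeriv ρ hρm hρ0 P Q hfin hl).continuousAt.continuousWithinAt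
    · rw [interior_Iio]
      intro l hl m hm hlm
      rw [(two_hasDeriv ρ hρm hρ0 P Q hfin hl).deriv, (two_hasDeriv ρ hρm hρ0 P Q hfin hm).deriv]
      exact two_strict ρ hρm hρ0 P Q hfin hlt hl hm hlm

end
end
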